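/- Let Γ be a countable amenable group and α a minimal action of Γ by homeomorphisms on the Cantor space X = {0,1}^ℕ. Let K(α) = {g ∈ Homeo(X) : g_*μ = μ for all μ ∈ M(α)}. Then the following are equivalent: (1) there exists a homeomorphism T of X such that the ℤ-action n ↦ Tⁿ has exactly the same set of invariant Borel probability measures as α; (2) α has measured comparison, i.e., for all clopen A, B ⊆ X with μ(A) < μ(B) for every μ ∈ M(α), there exist a partition A = A₁ ⊔ ⋯ ⊔ Aₙ into clopen sets and g₁,…,gₙ ∈ K(α) such that g₁A₁,…,gₙAₙ are pairwise disjoint and contained in B. -/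

import Mathlib

open MeasureTheory Set
open scoped ENNReal

/-! Preliminary definitions: the clopen type semigroup of an action of a group `Γ`
by homeomorphisms on a topological space `X`, invariant measures, dynamical comparison,
topological full groups, and the topology on spaces of actions. -/

/-- The group of self-homeomorphisms of `X`, with `(g * h) x = g (h x)`. -/
instance homeoGroup (X : Type*) [TopologicalSpace X] : Group (X ≃ₜ X) where
  mul g h := h.trans g
  one := Homeomorph.refl X
  inv := Homeomorph.symm
  mul_assoc a b c := Homeomorph.ext fun _ => rfl
  one_mul a := Homeomorph.ext fun _ => rfl
  mul_one a := Homeomorph.ext fun _ => rfl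
  inv_mul_cancel a := Homeomorph.ext fun x => a.symm_apply_apply x

/-- The Cantor space `{0,1}^ℕ`. -/
abbrev Cantor : Type := ℕ → Bool

section Defs

variable {Γ : Type*} [Group Γ] {X : Type*} [TopologicalSpace X]

/-- A left-invariant finitely additive probability measure on (the power set of) `Γ`,
with values in `[0,1]`. `Γ` is amenable iff such a measure exists. -/
def IsInvFapm {Γ : Type*} [Group Γ] (m : Set Γ → ℝ) : Prop :=
  (∀ E : Set Γ, 0 ≤ m E) ∧ (∀ E : Set Γ, m E ≤ 1) ∧ m Set.univ = 1 ∧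
  (∀ E F : Set Γ, Disjoint E F → m (E ∪ F) = m E + m F) ∧
  (∀ (γ : Γ) (E : Set Γ), m ((γ * ·) '' E) = m E)

/-- The action of `γ ∈ Γ` on continuous `ℕ`-valued functions: `(γ · f)(x) = f(γ⁻¹ · x)`. -/
def actC (α : Γ →* X ≃ₜ X) (γ : Γ) (f : C(X, ℕ)) : C(X, ℕ) :=
  f.comp (α γ⁻¹)

/-- The equidecomposability relation `∼` on `C(X, ℕ)`: `f ∼ g` iff `f = h₁ + ⋯ + hₙ`
and `g = γ₁·h₁ + ⋯ + γₙ·hₙ` for some `hᵢ ∈ C(X,ℕ)`, `γᵢ ∈ Γ`. -/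
def TypeRel (α : Γ →* X ≃ₜ X) (f g : C(X, ℕ)) : Prop :=
  ∃ (n : ℕ) (h : Fin n → C(X, ℕ)) (γ : Fin n → Γ),
    f = ∑ i, h i ∧ g = ∑ i, actC α (γ i) (h i)

/-- The additive congruence on `C(X, ℕ)` generated by `∼` (since `∼` is itself an
additive congruence, this is just `∼`). -/
def typeCon (α : Γ →* X ≃ₜ X) : AddCon C(X, ℕ) := addConGen (TypeRel α)

/-- The clopen type semigroup `T(α) = C(X,ℕ)/∼`. -/
abbrev TypeSemigroup (α : Γ →* X ≃ₜ X) := (typeCon α).Quotient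

/-- The class `[f] ∈ T(α)` of `f ∈ C(X, ℕ)`. -/
def cls (α : Γ →* X ≃ₜ X) (f : C(X, ℕ)) : TypeSemigroup α := (typeCon α).toQuotient f

/-- The algebraic preorder on `T(α)`: `a ≤ b` iff `a + c = b` for some `c`. -/
def tle (α : Γ →* X ≃ₜ X) (a b : TypeSemigroup α) : Prop := ∃ c, a + c = b

/-- `T(α)` is unperforated: `n • a ≤ n • b` implies `a ≤ b` for all `n ≥ 1`. -/
def IsUnperforated (α : Γ →* X ≃ₜ X) : Prop :=
  ∀ (a b : TypeSemigroup α) (n : ℕ), 1 ≤ n → tle α (n • a) (n • b) → tle α a b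

/-- `T(α)` is almost unperforated: `(n+1) • a ≤ n • b` implies `a ≤ b`. -/
def IsAlmostUnperforated (α : Γ →* X ≃ₜ X) : Prop :=
  ∀ (a b : TypeSemigroup α) (n : ℕ), tle α ((n + 1) • a) (n • b) → tle α a b

/-- `T(α)` is cancellative: `a + b = a + c` implies `b = c`. -/
def IsCancellative (α : Γ →* X ≃ₜ X) : Prop :=
  ∀ a b c : TypeSemigroup α, a + b = a + c → b = c

/-- The algebraic preorder on `T(α)` is a partial order, i.e. it is antisymmetric. -/
def TleAntisymm (α : Γ →* X ≃ₜ X) : Prop :=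
  ∀ a b : TypeSemigroup α, tle α a b → tle α b a → a = b

/-- `b` is an order unit of `T(α)`: every `a` satisfies `a ≤ k • b` for some `k ∈ ℕ`. -/
def IsOrderUnit (α : Γ →* X ≃ₜ X) (b : TypeSemigroup α) : Prop :=
  ∀ a : TypeSemigroup α, ∃ k : ℕ, tle α a (k • b)

/-- A state on `T(α)`: an additive map to `[0,∞]` sending `0` to `0`. -/
def IsState (α : Γ →* X ≃ₜ X) (ν : TypeSemigroup α → ℝ≥0∞) : Prop :=
  ν 0 = 0 ∧ ∀ a b : TypeSemigroup α, ν (a + b) = ν a + ν b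

/-- `M(α)`: the set of `Γ`-invariant Radon (regular Borel) probability measures on `X`. -/
def invRadon (α : Γ →* X ≃ₜ X) : Set (@Measure X (borel X)) :=
  letI : MeasurableSpace X := borel X
  {μ : Measure X | IsProbabilityMeasure μ ∧ μ.Regular ∧ ∀ γ : Γ, Measure.map ⇑(α γ) μ = μ}

/-- The set of `Γ`-invariant Borel probability measures on `X`. -/
def invBorel (α : Γ →* X ≃ₜ X) : Set (@Measure X (borel X)) :=
  letI : MeasurableSpace X := borel X
  {μ : Measure X | IsProbabilityMeasure μ ∧ ∀ γ : Γ, Measure.map ⇑(α γ) μ = μ}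

/-- `μ([f]) = ∫ f dμ`, the value of (the state associated with) a measure on the class of
`f ∈ C(X, ℕ)`. -/
noncomputable def intOf {X : Type*} [TopologicalSpace X] (μ : @Measure X (borel X))
    (f : C(X, ℕ)) : ℝ :=
  letI : MeasurableSpace X := borel X
  ∫ x, (f x : ℝ) ∂μ

/-- `A` is subequidecomposable to `B`: there are a partition `A = A₁ ⊔ ⋯ ⊔ Aₙ` into clopen
sets and `γ₁, …, γₙ ∈ Γ` with `γ₁A₁, …, γₙAₙ` pairwise disjoint and contained in `B`. -/
def Subequidecomposable (α : Γ →* X ≃ₜ X) (A B : Set X) : Prop :=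
  ∃ (n : ℕ) (P : Fin n → Set X) (γ : Fin n → Γ),
    (∀ i, IsClopen (P i)) ∧ (Pairwise fun i j => Disjoint (P i) (P j)) ∧
    (⋃ i, P i) = A ∧
    (Pairwise fun i j => Disjoint (⇑(α (γ i)) '' P i) (⇑(α (γ j)) '' P j)) ∧
    ∀ i, ⇑(α (γ i)) '' P i ⊆ B

/-- Dynamical comparison (with respect to invariant Radon probability measures): for all
clopen `A`, `B` with `B` nonempty and `μ(A) < μ(B)` for every `μ ∈ M(α)`, `A` is
subequidecomposable to `B`. -/
def DynComparison (α : Γ →* X ≃ₜ X) : Prop :=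
  ∀ A B : Set X, IsClopen A → IsClopen B → B.Nonempty →
    (∀ μ ∈ invRadon α, μ A < μ B) → Subequidecomposable α A B

/-- Dynamical comparison (with respect to invariant Borel probability measures). -/
def DynComparisonBorel (α : Γ →* X ≃ₜ X) : Prop :=
  ∀ A B : Set X, IsClopen A → IsClopen B → B.Nonempty →
    (∀ μ ∈ invBorel α, μ A < μ B) → Subequidecomposable α A B

/-- The action `α` is minimal: the only closed invariant subsets are `∅` and `X`. -/
def IsMinimalAction (α : Γ →* X ≃ₜ X) : Prop :=
  ∀ F : Set X, IsClosed F → (∀ γ : Γ, ⇑(α γ) '' F ⊆ F) → F = ∅ ∨ F = Set.univ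

/-- Membership in the topological full group `⟦α⟧`: `g` coincides with elements of the
action on the pieces of a finite clopen partition of `X`. -/
def InTopFullGroup (α : Γ →* X ≃ₜ X) (g : X ≃ₜ X) : Prop :=
  ∃ (n : ℕ) (P : Fin n → Set X) (γ : Fin n → Γ),
    (∀ i, IsClopen (P i)) ∧ (Pairwise fun i j => Disjoint (P i) (P j)) ∧
    (⋃ i, P i) = Set.univ ∧ ∀ i, ∀ x ∈ P i, g x = α (γ i) x

/-- `⟦α⟧` admits a dense locally finite subgroup: there is a subgroup `Λ` of `Homeo(X)`
contained in `⟦α⟧`, locally finite (all its finitely generated subgroups are finite), and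
dense in `⟦α⟧` for the topology whose basic neighborhoods of `h` are
`{g : g A = h A for all A ∈ 𝒜}`, `𝒜` ranging over finite clopen partitions of `X`. -/
def HasDenseLocallyFiniteSubgroup (α : Γ →* X ≃ₜ X) : Prop :=
  ∃ Λ : Subgroup (X ≃ₜ X),
    ((Λ : Set (X ≃ₜ X)) ⊆ {g | InTopFullGroup α g}) ∧
    (∀ s : Finset (X ≃ₜ X), (s : Set (X ≃ₜ X)) ⊆ (Λ : Set (X ≃ₜ X)) →
      ((Subgroup.closure (s : Set (X ≃ₜ X)) : Subgroup (X ≃ₜ X)) : Set (X ≃ₜ X)).Finite) ∧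
    ∀ g : X ≃ₜ X, InTopFullGroup α g →
      ∀ (n : ℕ) (P : Fin n → Set X), (∀ i, IsClopen (P i)) →
        (Pairwise fun i j => Disjoint (P i) (P j)) → (⋃ i, P i) = Set.univ →
        ∃ l ∈ Λ, ∀ i, ⇑l '' P i = ⇑g '' P i

end Defs

/-- The topology on `Homeo(X)` whose basic neighborhoods of `h` are the sets
`{g : g A = h A for all A ∈ 𝒜}`, for `𝒜` a finite clopen partition of `X`; equivalently,
the topology generated by the sets `{g : g '' A = B}` for `A`, `B` clopen. -/
def homeoTop (X : Type*) [TopologicalSpace X] : TopologicalSpace (X ≃ₜ X) :=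
  TopologicalSpace.generateFrom
    {U | ∃ A B : Set X, IsClopen A ∧ IsClopen B ∧ U = {g : X ≃ₜ X | ⇑g '' A = B}}

/-- The topology on the space `A(Γ)` of actions of `Γ` on `X`, induced from the product
topology on `Homeo(X)^Γ`. -/
def actionTop (Γ : Type*) [Group Γ] (X : Type*) [TopologicalSpace X] :
    TopologicalSpace (Γ →* (X ≃ₜ X)) :=
  letI := homeoTop X
  TopologicalSpace.induced (fun φ : Γ →* (X ≃ₜ X) => ⇑φ) Pi.topologicalSpace

set_option linter.unusedSectionVars false
open MeasureTheory Set
open scoped ENNReal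

section PA
variable {X : Type*} [TopologicalSpace X] [CompactSpace X] [T2Space X] [TotallyDisconnectedSpace X]

lemma clopen_ring : IsSetRing {A : Set X | IsClopen A} where
  empty_mem := isClopen_empty
  union_mem := fun _ _ h1 h2 => h1.union h2
  sdiff_mem := fun _ _ h1 h2 => h1.diff h2

lemma exists_measure_of_finadd [SecondCountableTopology X] [MeasurableSpace X] [BorelSpace X]
    (l : Set X → ℝ) (h0 : ∀ A, IsClopen A → 0 ≤ l A)
    (h1 : l univ = 1)
    (hadd : ∀ A B, IsClopen A → IsClopen B → Disjoint A B → l (A ∪ B) = l A + l B) :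
    ∃ μ : Measure X, IsProbabilityMeasure μ ∧ ∀ A, IsClopen A → μ A = ENNReal.ofReal (l A) := by
  have he : l ∅ = 0 := by
    have := hadd ∅ ∅ isClopen_empty isClopen_empty (by simp)
    simp at this; exact this
  let m : AddContent ℝ≥0∞ {A : Set X | IsClopen A} :=
    clopen_ring.addContent_of_union (fun A => ENNReal.ofReal (l A)) (by simp [he])
      (fun {s t} hs ht hd => by
        rw [hadd s t hs ht hd, ENNReal.ofReal_add (h0 _ hs) (h0 _ ht)])
  have hm : ∀ A, m A = ENNReal.ofReal (l A) := fun A => rfl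
  have hsub : m.IsSigmaSubadditive := by
    intro f hf hU
    have hc : IsCompact (⋃ i, f i) := IsClosed.isCompact (IsClopen.isClosed hU)
    obtain ⟨t, ht⟩ := hc.elim_finite_subcover f (fun i => (hf i).isOpen) subset_rfl
    calc m (⋃ i, f i) ≤ m (⋃ i ∈ t, f i) := by
            refine addContent_mono clopen_ring.isSetSemiring hU ?_ ht
            exact clopen_ring.biUnion_mem t (fun i _ => hf i)
      _ ≤ ∑ i ∈ t, m (f i) := addContent_biUnion_le clopen_ring (fun i _ => hf i)
      _ ≤ ∑' i, m (f i) := ENNReal.sum_le_tsum t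
  have hgen : (inferInstance : MeasurableSpace X) = MeasurableSpace.generateFrom {A : Set X | IsClopen A} := by
    rw [BorelSpace.measurable_eq (α := X)]
    exact isTopologicalBasis_isClopen.borel_eq_generateFrom
  refine ⟨m.measure clopen_ring.isSetSemiring hgen.le hsub, ⟨?_⟩, ?_⟩
  · rw [m.measure_eq clopen_ring.isSetSemiring hgen hsub (s := univ) isClopen_univ, hm, h1]; simp
  · intro A hA
    rw [m.measure_eq clopen_ring.isSetSemiring hgen hsub (s := A) hA, hm]

lemma measure_ext_clopen [SecondCountableTopology X] [MeasurableSpace X] [BorelSpace X]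
    (μ ν : Measure X) [IsFiniteMeasure μ]
    (h : ∀ A, IsClopen A → μ A = ν A) : μ = ν := by
  have hgen : (inferInstance : MeasurableSpace X) = MeasurableSpace.generateFrom {A : Set X | IsClopen A} := by
    rw [BorelSpace.measurable_eq (α := X)]
    exact isTopologicalBasis_isClopen.borel_eq_generateFrom
  refine ext_of_generate_finite _ hgen ?_ (fun s hs => h s hs) (h _ isClopen_univ)
  intro s hs t ht _
  exact IsClopen.inter hs ht

lemma map_eq_of_clopen [SecondCountableTopology X] [MeasurableSpace X] [BorelSpace X]
    (μ : Measure X) [IsFiniteMeasure μ] (g : X ≃ₜ X)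
    (h : ∀ A, IsClopen A → μ (g ⁻¹' A) = μ A) : Measure.map g μ = μ := by
  symm
  apply measure_ext_clopen
  intro A hA
  rw [Measure.map_apply g.continuous.measurable hA.isOpen.measurableSet, h A hA]

lemma measure_preimage_of_map [MeasurableSpace X] [BorelSpace X]
    (μ : Measure X) (g : X ≃ₜ X) (h : Measure.map g μ = μ)
    (A : Set X) (hA : IsClopen A) : μ (g ⁻¹' A) = μ A := by
  conv_rhs => rw [← h]
  rw [Measure.map_apply g.continuous.measurable hA.isOpen.measurableSet]

lemma homeo_pow_coe (T : X ≃ₜ X) (n : ℕ) : ⇑(T ^ n) = T^[n] := by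
  induction n with
  | zero => rfl
  | succ n ih =>
    rw [pow_succ, Function.iterate_succ, ← ih]; rfl

/-- Krylov–Bogoliubov, with comparison of two clopen sets along an orbit. -/
lemma exists_inv_measure [SecondCountableTopology X] [MeasurableSpace X] [BorelSpace X]
    (T : X ≃ₜ X) (x : X) (A B : Set X) (hA : IsClopen A) (hB : IsClopen B)
    (h : ∀ n : ℕ, (∑ i ∈ Finset.range (n+1), B.indicator (fun _ => (1:ℝ)) (T^[i] x)) ≤
        ∑ i ∈ Finset.range (n+1), A.indicator (fun _ => (1:ℝ)) (T^[i] x)) :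
    ∃ μ : Measure X, IsProbabilityMeasure μ ∧ Measure.map T μ = μ ∧ μ B ≤ μ A := by
  classical
  let a : Set X → ℕ → ℝ := fun C n =>
    (∑ i ∈ Finset.range (n+1), C.indicator (fun _ => (1:ℝ)) (T^[i] x)) / (n+1)
  have hind : ∀ (C : Set X) y, 0 ≤ C.indicator (fun _ => (1:ℝ)) y ∧ C.indicator (fun _ => (1:ℝ)) y ≤ 1 := by
    intro C y
    by_cases hy : y ∈ C <;> simp [hy]
  have ha : ∀ C n, a C n ∈ Icc (0:ℝ) 1 := by
    intro C n
    constructor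
    · apply div_nonneg
      · exact Finset.sum_nonneg (fun i _ => (hind C _).1)
      · positivity
    · apply div_le_one_of_le₀ _ (by positivity)
      calc _ ≤ ∑ i ∈ Finset.range (n+1), (1:ℝ) := Finset.sum_le_sum (fun i _ => (hind C _).2)
        _ = _ := by simp
  have hl : ∀ C, ∃ l : ℝ, Filter.Tendsto (a C) (Filter.hyperfilter ℕ : Filter ℕ) (nhds l) := by
    intro C
    obtain ⟨l, _, hl⟩ := (isCompact_Icc (a := (0:ℝ)) (b := 1)).ultrafilter_le_nhds
      ((Filter.hyperfilter ℕ).map (a C)) (by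
        rw [Filter.le_principal_iff]
        exact Filter.mem_map.2 (Filter.Eventually.of_forall (ha C)))
    exact ⟨l, hl⟩
  choose l hl using hl
  have huniv : l univ = 1 := by
    refine tendsto_nhds_unique (hl univ) ?_
    have : a univ = fun _ => 1 := by
      funext n; simp only [a]; simp
      have h9 : (n:ℝ)+1 ≠ 0 := by positivity
      field_simp
      try exact h9
    rw [this]; exact tendsto_const_nhds
  have hadd : ∀ C D, Disjoint C D → l (C ∪ D) = l C + l D := by
    intro C D hCD
    refine tendsto_nhds_unique (hl _) ?_
    have : a (C ∪ D) = fun n => a C n + a D n := by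
      funext n; simp only [a]
      rw [← add_div, ← Finset.sum_add_distrib]
      congr 2
      funext i
      rw [Set.indicator_union_of_disjoint hCD]
    rw [this]; exact (hl C).add (hl D)
  obtain ⟨μ, hp, hμ⟩ := exists_measure_of_finadd l
    (fun C _ => ge_of_tendsto' (hl C) (fun n => (ha C n).1)) huniv (fun C D _ _ => hadd C D)
  refine ⟨μ, hp, ?_, ?_⟩
  · apply map_eq_of_clopen
    intro C hC
    rw [hμ _ hC, hμ _ (hC.preimage T.continuous)]
    congr 1
    have hz : Filter.Tendsto (fun n => a (T ⁻¹' C) n - a C n) (Filter.hyperfilter ℕ : Filter ℕ) (nhds 0) := by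
      apply Filter.Tendsto.mono_left _ Nat.hyperfilter_le_atTop
      apply squeeze_zero_norm' (a := fun n : ℕ => 1 / ((n:ℝ)+1))
      · refine Filter.Eventually.of_forall fun n => ?_
        have : a (T ⁻¹' C) n - a C n = (C.indicator (fun _ => (1:ℝ)) (T^[n+1] x)
            - C.indicator (fun _ => (1:ℝ)) (T^[0] x)) / (n+1) := by
          simp only [a]
          rw [← sub_div, ← Finset.sum_range_sub (fun i => C.indicator (fun _ => (1:ℝ)) (T^[i] x)),
            ← Finset.sum_sub_distrib]
          congr 1
          apply Finset.sum_congr rfl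
          intro i _
          rw [Function.iterate_succ_apply']
          rfl
        rw [this, norm_div]
        have h2 : ‖(n:ℝ)+1‖ = n+1 := by rw [Real.norm_of_nonneg]; positivity
        rw [h2]
        gcongr
        rw [Real.norm_eq_abs, abs_le]
        have h3 := hind C (T^[n+1] x)
        have h4 := hind C (T^[0] x)
        constructor <;> linarith [h3.1, h3.2, h4.1, h4.2]
      · exact tendsto_one_div_add_atTop_nhds_zero_nat
    have := tendsto_nhds_unique hz ((hl _).sub (hl _))
    linarith
  · rw [hμ _ hA, hμ _ hB]
    apply ENNReal.ofReal_le_ofReal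
    refine le_of_tendsto_of_tendsto' (hl B) (hl A) fun n => ?_
    simp only [a]
    exact div_le_div_of_nonneg_right (h n) (by positivity)

end PA
set_option linter.unusedSectionVars false
open MeasureTheory Set
open scoped ENNReal

section PB
variable {X : Type*} [TopologicalSpace X] [CompactSpace X] [T2Space X] [TotallyDisconnectedSpace X]

/-- Greedy matching: points of `A` matched at stage exactly `n`, given remaining sets. State is
`(remaining A, remaining B)` before stage `n`. -/
def greedy (T : X ≃ₜ X) (A B : Set X) : ℕ → Set X × Set X
  | 0 => (A, B)
  | n+1 => let s := greedy T A B n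
    (s.1 \ (T^[n] ⁻¹' s.2), s.2 \ (T^[n] '' s.1))

def gpiece (T : X ≃ₜ X) (A B : Set X) (n : ℕ) : Set X :=
  (greedy T A B n).1 ∩ (T^[n] ⁻¹' (greedy T A B n).2)

lemma iter_inj (T : X ≃ₜ X) (n : ℕ) : Function.Injective (T^[n]) := T.injective.iterate n

lemma isClopen_iter_image (T : X ≃ₜ X) (n : ℕ) {A : Set X} (hA : IsClopen A) :
    IsClopen (T^[n] '' A) := by
  rw [← homeo_pow_coe]
  exact ⟨(T^n).isClosed_image.2 hA.1, (T^n).isOpen_image.2 hA.2⟩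

lemma isClopen_iter_preimage (T : X ≃ₜ X) (n : ℕ) {A : Set X} (hA : IsClopen A) :
    IsClopen (T^[n] ⁻¹' A) := hA.preimage (T.continuous.iterate n)

lemma greedy_clopen (T : X ≃ₜ X) (A B : Set X) (hA : IsClopen A) (hB : IsClopen B) (n : ℕ) :
    IsClopen (greedy T A B n).1 ∧ IsClopen (greedy T A B n).2 := by
  induction n with
  | zero => exact ⟨hA, hB⟩
  | succ n ih =>
    exact ⟨ih.1.diff (isClopen_iter_preimage T n ih.2), ih.2.diff (isClopen_iter_image T n ih.1)⟩

lemma gpiece_clopen (T : X ≃ₜ X) (A B : Set X) (hA : IsClopen A) (hB : IsClopen B) (n : ℕ) :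
    IsClopen (gpiece T A B n) :=
  (greedy_clopen T A B hA hB n).1.inter (isClopen_iter_preimage T n (greedy_clopen T A B hA hB n).2)

lemma greedy_anti (T : X ≃ₜ X) (A B : Set X) {m n : ℕ} (h : m ≤ n) :
    (greedy T A B n).1 ⊆ (greedy T A B m).1 ∧ (greedy T A B n).2 ⊆ (greedy T A B m).2 := by
  induction n, h using Nat.le_induction with
  | base => exact ⟨subset_rfl, subset_rfl⟩
  | succ n _ ih => exact ⟨sdiff_subset.trans ih.1, sdiff_subset.trans ih.2⟩

lemma gpiece_disj (T : X ≃ₜ X) (A B : Set X) {m n : ℕ} (h : m < n) :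
    Disjoint (gpiece T A B m) (gpiece T A B n) := by
  rw [Set.disjoint_left]
  intro x hx hx'
  have := (greedy_anti T A B (Nat.succ_le_of_lt h)).1 hx'.1
  exact this.2 hx.2

lemma gpiece_disj' (T : X ≃ₜ X) (A B : Set X) {m n : ℕ} (h : m < n) :
    Disjoint (T^[m] '' gpiece T A B m) (T^[n] '' gpiece T A B n) := by
  rw [Set.disjoint_left]
  rintro _ ⟨x, hx, rfl⟩ ⟨y, hy, hxy⟩
  have := (greedy_anti T A B (Nat.succ_le_of_lt h)).2 hy.2
  rw [hxy] at this
  exact this.2 ⟨x, hx.1, rfl⟩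

lemma mem_A_split (T : X ≃ₜ X) (A B : Set X) (n : ℕ) (x : X) (hx : x ∈ A) :
    x ∈ (greedy T A B n).1 ∨ ∃ k < n, x ∈ gpiece T A B k := by
  induction n with
  | zero => exact Or.inl hx
  | succ n ih =>
    rcases ih with h | ⟨k, hk, h⟩
    · by_cases h2 : x ∈ T^[n] ⁻¹' (greedy T A B n).2
      · exact Or.inr ⟨n, Nat.lt_succ_self n, h, h2⟩
      · exact Or.inl ⟨h, h2⟩
    · exact Or.inr ⟨k, by omega, h⟩

lemma mem_B_split (T : X ≃ₜ X) (A B : Set X) (n : ℕ) (x : X) (hx : x ∈ B) :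
    x ∈ (greedy T A B n).2 ∨ ∃ k < n, x ∈ T^[k] '' gpiece T A B k := by
  induction n with
  | zero => exact Or.inl hx
  | succ n ih =>
    rcases ih with h | ⟨k, hk, h⟩
    · by_cases h2 : x ∈ T^[n] '' (greedy T A B n).1
      · obtain ⟨y, hy, rfl⟩ := h2
        exact Or.inr ⟨n, Nat.lt_succ_self n, y, ⟨hy, h⟩, rfl⟩
      · exact Or.inl ⟨h, h2⟩
    · exact Or.inr ⟨k, by omega, h⟩

lemma greedy_count (T : X ≃ₜ X) (A B : Set X) (n : ℕ) (x : X) (hx : x ∈ (greedy T A B (n+1)).1) :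
    (∑ i ∈ Finset.range (n+1), B.indicator (fun _ => (1:ℝ)) (T^[i] x)) ≤
        ∑ i ∈ Finset.range (n+1), A.indicator (fun _ => (1:ℝ)) (T^[i] x) := by
  classical
  have key : ∀ (C : Set X), (∑ i ∈ Finset.range (n+1), C.indicator (fun _ => (1:ℝ)) (T^[i] x))
      = (((Finset.range (n+1)).filter (fun i => T^[i] x ∈ C)).card : ℝ) := by
    intro C
    rw [Finset.card_filter]
    push_cast
    rfl
  rw [key, key]
  norm_cast
  have h : ∀ i ∈ (Finset.range (n+1)).filter (fun i => T^[i] x ∈ B),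
      ∃ k ≤ i, T^[i-k] x ∈ gpiece T A B k := by
    intro i hi
    rw [Finset.mem_filter, Finset.mem_range] at hi
    rcases mem_B_split T A B i _ hi.2 with h | ⟨k, hk, y, hy, hxy⟩
    · exfalso
      have := (greedy_anti T A B (show i + 1 ≤ n + 1 by omega)).1 hx
      exact this.2 h
    · refine ⟨k, hk.le, ?_⟩
      have : y = T^[i-k] x := by
        apply iter_inj T k
        rw [hxy, ← Function.iterate_add_apply]
        congr 2; omega
      rwa [← this]
  choose! k hk using h
  apply Finset.card_le_card_of_injOn (fun i => i - k i)
  · intro i hi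
    have h1 := hk i hi
    rw [Finset.mem_coe, Finset.mem_filter, Finset.mem_range] at hi
    simp only [Finset.coe_filter, Finset.mem_range, mem_ofPred_eq]
    exact ⟨by omega, (greedy_anti T A B (Nat.zero_le _)).1 h1.2.1⟩
  · intro i hi j hj hij
    have h1 := hk i hi
    have h2 := hk j hj
    simp only at hij
    rw [← hij] at h2
    rcases lt_trichotomy (k i) (k j) with h | h | h
    · exact absurd h2.2 (Set.disjoint_left.1 (gpiece_disj T A B h) h1.2)
    · omega
    · exact absurd h1.2 (Set.disjoint_left.1 (gpiece_disj T A B h) h2.2)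

theorem dir1 [SecondCountableTopology X] [MeasurableSpace X] [BorelSpace X]
    (T : X ≃ₜ X) (A B : Set X) (hA : IsClopen A) (hB : IsClopen B)
    (h : ∀ μ : Measure X, IsProbabilityMeasure μ → Measure.map T μ = μ → μ A < μ B) :
    ∃ (n : ℕ) (P : Fin n → Set X) (g : Fin n → X ≃ₜ X),
          (∀ i, ∀ μ : Measure X, Measure.map T μ = μ → Measure.map ⇑(g i) μ = μ) ∧
          (∀ i, IsClopen (P i)) ∧
          (Pairwise fun i j => Disjoint (P i) (P j)) ∧
          (⋃ i, P i) = A ∧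
          (Pairwise fun i j => Disjoint (⇑(g i) '' P i) (⇑(g j) '' P j)) ∧
          ∀ i, ⇑(g i) '' P i ⊆ B := by
  have hN : ∃ N, (greedy T A B N).1 = ∅ := by
    by_contra hne
    push Not at hne
    obtain ⟨x, hx⟩ := IsCompact.nonempty_iInter_of_sequence_nonempty_isCompact_isClosed
      (fun n => (greedy T A B n).1) (fun n => (greedy_anti T A B (Nat.le_succ n)).1)
      hne (greedy_clopen T A B hA hB 0).1.1.isCompact
      (fun n => (greedy_clopen T A B hA hB n).1.1)
    rw [mem_iInter] at hx
    obtain ⟨μ, hp, hT, hle⟩ := exists_inv_measure T x A B hA hB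
      (fun n => greedy_count T A B n x (hx (n+1)))
    exact absurd (h μ hp hT) (not_lt.2 hle)
  obtain ⟨N, hN⟩ := hN
  refine ⟨N, fun i => gpiece T A B i, fun i => T ^ (i:ℕ), ?_, ?_, ?_, ?_, ?_, ?_⟩
  · intro i μ hμ
    beta_reduce
    generalize (i:ℕ) = k
    induction k with
    | zero => exact Measure.map_id
    | succ k ih =>
      rw [pow_succ]
      change Measure.map (⇑(T^k) ∘ ⇑T) μ = μ
      rw [← Measure.map_map (T^k).continuous.measurable T.continuous.measurable, hμ, ih]
  · exact fun i => gpiece_clopen T A B hA hB i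
  · intro i j hij
    rcases lt_or_gt_of_ne (Fin.val_injective.ne hij) with h | h
    · exact gpiece_disj T A B h
    · exact (gpiece_disj T A B h).symm
  · ext x
    rw [mem_iUnion]
    constructor
    · rintro ⟨i, hi⟩
      exact (greedy_anti T A B (Nat.zero_le _)).1 hi.1
    · intro hx
      rcases mem_A_split T A B N x hx with h | ⟨k, hk, h⟩
      · rw [hN] at h; exact absurd h (notMem_empty x)
      · exact ⟨⟨k, hk⟩, h⟩
  · intro i j hij
    simp only [homeo_pow_coe]
    rcases lt_or_gt_of_ne (Fin.val_injective.ne hij) with h | h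
    · exact gpiece_disj' T A B h
    · exact (gpiece_disj' T A B h).symm
  · rintro i _ ⟨x, hx, rfl⟩
    rw [homeo_pow_coe]
    exact (greedy_anti T A B (Nat.zero_le _)).2 hx.2

end PB
set_option linter.unusedSectionVars false
open MeasureTheory Set
open scoped ENNReal

section PC
variable {X : Type*}

def bse : List (Set X) → Set X
  | [] => ∅
  | L :: _ => L

def tp : List (Set X) → Set X
  | [] => ∅
  | [L] => L
  | _ :: L' :: σ => tp (L' :: σ)

def prs : List (Set X) → List (Set X × Set X)
  | [] => []
  | [_] => []
  | L :: L' :: σ => (L, L') :: prs (L' :: σ)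

def Bs (Ξ : List (List (Set X))) : Set X := {x | ∃ τ ∈ Ξ, x ∈ bse τ}
def Tp (Ξ : List (List (Set X))) : Set X := {x | ∃ τ ∈ Ξ, x ∈ tp τ}
def Lk (Ξ : List (List (Set X))) (x y : X) : Prop := ∃ τ ∈ Ξ, ∃ p ∈ prs τ, x ∈ p.1 ∧ y ∈ p.2
def Rl (Ξ : List (List (Set X))) (x y : X) : Prop := Lk Ξ x y ∨ (x ∈ Tp Ξ ∧ y ∈ Bs Ξ)

open Classical in
noncomputable def ct (τ : List (Set X)) (x : X) : ℕ := (τ.map (fun L => if x ∈ L then 1 else 0)).sum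
noncomputable def cnt (Ξ : List (List (Set X))) (x : X) : ℕ := (Ξ.map (fun τ => ct τ x)).sum

structure Ref (Ξ Ξ' : List (List (Set X))) : Prop where
  cnt : ∀ x, cnt Ξ' x = cnt Ξ x
  lk : ∀ x y, Lk Ξ' x y → Rl Ξ x y
  bs : Bs Ξ' ⊆ Bs Ξ
  tp : Tp Ξ' ⊆ Tp Ξ
  lev : ∀ τ' ∈ Ξ', ∀ L' ∈ τ', ∃ τ ∈ Ξ, ∃ L ∈ τ, L' ⊆ L

lemma Ref.rl {Ξ Ξ' : List (List (Set X))} (h : Ref Ξ Ξ') {x y : X} (hr : Rl Ξ' x y) : Rl Ξ x y := by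
  rcases hr with h1 | ⟨h1, h2⟩
  · exact h.lk _ _ h1
  · exact Or.inr ⟨h.tp h1, h.bs h2⟩

lemma Ref.refl (Ξ : List (List (Set X))) : Ref Ξ Ξ :=
  ⟨fun _ => rfl, fun _ _ h => Or.inl h, subset_rfl, subset_rfl, fun τ h L hL => ⟨τ, h, L, hL, subset_rfl⟩⟩

lemma Ref.trans {a b c : List (List (Set X))} (h1 : Ref a b) (h2 : Ref b c) : Ref a c where
  cnt x := (h2.cnt x).trans (h1.cnt x)
  lk x y h := h1.rl (h2.lk x y h)
  bs := h2.bs.trans h1.bs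
  tp := h2.tp.trans h1.tp
  lev := by
    intro τ hτ L hL
    obtain ⟨τ1, h3, L1, h4, h5⟩ := h2.lev τ hτ L hL
    obtain ⟨τ2, h6, L2, h7, h8⟩ := h1.lev τ1 h3 L1 h4
    exact ⟨τ2, h6, L2, h7, h5.trans h8⟩

lemma Ref.perm {a b : List (List (Set X))} (h : a.Perm b) : Ref a b where
  cnt x := ((h.map _).sum_eq).symm
  lk := by
    rintro x y ⟨τ, hτ, r⟩
    exact Or.inl ⟨τ, h.mem_iff.2 hτ, r⟩
  bs := by rintro x ⟨τ, hτ, r⟩; exact ⟨τ, h.mem_iff.2 hτ, r⟩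
  tp := by rintro x ⟨τ, hτ, r⟩; exact ⟨τ, h.mem_iff.2 hτ, r⟩
  lev := fun τ hτ L hL => ⟨τ, h.mem_iff.2 hτ, L, hL, subset_rfl⟩

lemma Bs_append (a b : List (List (Set X))) : Bs (a ++ b) = Bs a ∪ Bs b := by
  ext x; simp only [Bs, List.mem_append, mem_union, mem_ofPred_eq]; grind

lemma Tp_append (a b : List (List (Set X))) : Tp (a ++ b) = Tp a ∪ Tp b := by
  ext x; simp only [Tp, List.mem_append, mem_union, mem_ofPred_eq]; grind

lemma Bs_cons (a : List (Set X)) (b : List (List (Set X))) : Bs (a :: b) = bse a ∪ Bs b := by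
  ext x; simp only [Bs, List.mem_cons, mem_union, mem_ofPred_eq]; grind

lemma Tp_cons (a : List (Set X)) (b : List (List (Set X))) : Tp (a :: b) = tp a ∪ Tp b := by
  ext x; simp only [Tp, List.mem_cons, mem_union, mem_ofPred_eq]; grind

lemma Bs_nil : Bs ([] : List (List (Set X))) = ∅ := by ext x; simp [Bs]
lemma Tp_nil : Tp ([] : List (List (Set X))) = ∅ := by ext x; simp [Tp]

lemma Lk_append (a b : List (List (Set X))) (x y : X) : Lk (a ++ b) x y ↔ Lk a x y ∨ Lk b x y := by
  simp only [Lk, List.mem_append]; grind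

lemma Lk_cons (a : List (Set X)) (b : List (List (Set X))) (x y : X) :
    Lk (a :: b) x y ↔ (∃ p ∈ prs a, x ∈ p.1 ∧ y ∈ p.2) ∨ Lk b x y := by
  simp only [Lk, List.mem_cons]; grind

lemma cnt_append (a b : List (List (Set X))) (x : X) : cnt (a ++ b) x = cnt a x + cnt b x := by
  simp [cnt]

lemma cnt_cons (a : List (Set X)) (b : List (List (Set X))) (x : X) :
    cnt (a :: b) x = ct a x + cnt b x := by simp [cnt]
lemma cnt_nil (x : X) : cnt ([] : List (List (Set X))) x = 0 := by simp [cnt]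

lemma Ref.app {a a' b b' : List (List (Set X))} (h1 : Ref a a') (h2 : Ref b b') :
    Ref (a ++ b) (a' ++ b') where
  cnt x := by rw [cnt_append, cnt_append, h1.cnt, h2.cnt]
  lk x y h := by
    rw [Lk_append] at h
    unfold Rl
    rw [Lk_append, Tp_append, Bs_append]
    rcases h with h | h
    · rcases h1.lk x y h with h | ⟨h, h'⟩
      · exact Or.inl (Or.inl h)
      · exact Or.inr ⟨Or.inl h, Or.inl h'⟩
    · rcases h2.lk x y h with h | ⟨h, h'⟩
      · exact Or.inl (Or.inr h)
      · exact Or.inr ⟨Or.inr h, Or.inr h'⟩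
  bs := by rw [Bs_append, Bs_append]; exact union_subset_union h1.bs h2.bs
  tp := by rw [Tp_append, Tp_append]; exact union_subset_union h1.tp h2.tp
  lev := by
    intro τ hτ L hL
    rcases List.mem_append.1 hτ with h | h
    · obtain ⟨t, ht, r⟩ := h1.lev τ h L hL
      exact ⟨t, List.mem_append_left _ ht, r⟩
    · obtain ⟨t, ht, r⟩ := h2.lev τ h L hL
      exact ⟨t, List.mem_append_right _ ht, r⟩

/-- pointwise inclusion of towers -/
abbrev SubT (τ' τ : List (Set X)) : Prop := List.Forall₂ (· ⊆ ·) τ' τ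

lemma SubT.bse {τ' τ : List (Set X)} (h : SubT τ' τ) : bse τ' ⊆ bse τ := by
  cases h with
  | nil => exact subset_rfl
  | cons h _ => exact h

lemma SubT.tp {τ' τ : List (Set X)} (h : SubT τ' τ) : tp τ' ⊆ tp τ := by
  induction h with
  | nil => exact subset_rfl
  | cons h h2 ih =>
    cases h2 with
    | nil => exact h
    | cons h3 h4 => exact ih

lemma SubT.prs {τ' τ : List (Set X)} (h : SubT τ' τ) :
    ∀ p ∈ prs τ', ∃ q ∈ prs τ, p.1 ⊆ q.1 ∧ p.2 ⊆ q.2 := by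
  induction h with
  | nil => intro p hp; simp [_root_.prs] at hp
  | cons h h2 ih =>
    cases h2 with
    | nil => intro p hp; simp [_root_.prs] at hp
    | cons h3 h4 =>
      intro p hp
      simp only [_root_.prs, List.mem_cons] at hp
      rcases hp with rfl | hp
      · exact ⟨_, List.mem_cons_self, h, h3⟩
      · obtain ⟨q, hq, r⟩ := ih p hp
        exact ⟨q, List.mem_cons_of_mem _ hq, r⟩

lemma SubT.lev {τ' τ : List (Set X)} (h : SubT τ' τ) : ∀ L' ∈ τ', ∃ L ∈ τ, L' ⊆ L := by
  induction h with
  | nil => intro p hp; simp at hp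
  | cons h h2 ih =>
    intro p hp
    rcases List.mem_cons.1 hp with rfl | hp
    · exact ⟨_, List.mem_cons_self, h⟩
    · obtain ⟨q, hq, r⟩ := ih p hp
      exact ⟨q, List.mem_cons_of_mem _ hq, r⟩

inductive Split : List (Set X) → List (Set X) → List (Set X) → Prop
  | nil : Split [] [] []
  | cons {L L1 L2 : Set X} {σ σ1 σ2 : List (Set X)} : L = L1 ∪ L2 → Disjoint L1 L2 → Split σ σ1 σ2 →
      Split (L :: σ) (L1 :: σ1) (L2 :: σ2)

lemma Split.sub1 {τ τ1 τ2 : List (Set X)} (h : Split τ τ1 τ2) : SubT τ1 τ := by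
  induction h with
  | nil => exact .nil
  | cons h1 h2 h3 ih => exact .cons (h1 ▸ subset_union_left) ih

lemma Split.sub2 {τ τ1 τ2 : List (Set X)} (h : Split τ τ1 τ2) : SubT τ2 τ := by
  induction h with
  | nil => exact .nil
  | cons h1 h2 h3 ih => exact .cons (h1 ▸ subset_union_right) ih

lemma Split.ct {τ τ1 τ2 : List (Set X)} (h : Split τ τ1 τ2) (x : X) : ct τ x = ct τ1 x + ct τ2 x := by
  induction h with
  | nil => simp [_root_.ct]
  | @cons L L1 L2 _ _ _ h1 h2 h3 ih =>
    subst h1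
    simp only [_root_.ct, List.map_cons, List.sum_cons] at ih ⊢
    have : x ∈ L1 → x ∉ L2 := fun h => Set.disjoint_left.1 h2 h
    by_cases a : x ∈ L1 <;> by_cases b : x ∈ L2 <;> simp_all <;> omega

lemma Split.append {τ τ1 τ2 σ σ1 σ2 : List (Set X)} (h : Split τ τ1 τ2) (h' : Split σ σ1 σ2) :
    Split (τ ++ σ) (τ1 ++ σ1) (τ2 ++ σ2) := by
  induction h with
  | nil => exact h'
  | cons h1 h2 h3 ih => exact .cons h1 h2 ih

lemma Split.ref {τ τ1 τ2 : List (Set X)} (h : Split τ τ1 τ2) : Ref [τ] [τ1, τ2] where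
  cnt x := by rw [cnt_cons, cnt_cons, cnt_cons, cnt_nil, h.ct]; omega
  lk := by
    rintro x y ⟨σ, hσ, p, hp, hx, hy⟩
    have hs : SubT σ τ := by
      simp at hσ; rcases hσ with rfl | rfl
      exacts [h.sub1, h.sub2]
    obtain ⟨q, hq, r1, r2⟩ := hs.prs p hp
    exact Or.inl ⟨τ, by simp, q, hq, r1 hx, r2 hy⟩
  bs := by
    rintro x ⟨σ, hσ, hx⟩
    have hs : SubT σ τ := by
      simp at hσ; rcases hσ with rfl | rfl
      exacts [h.sub1, h.sub2]
    exact ⟨τ, by simp, hs.bse hx⟩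
  tp := by
    rintro x ⟨σ, hσ, hx⟩
    have hs : SubT σ τ := by
      simp at hσ; rcases hσ with rfl | rfl
      exacts [h.sub1, h.sub2]
    exact ⟨τ, by simp, hs.tp hx⟩
  lev := by
    intro σ hσ L hL
    have hs : SubT σ τ := by
      simp at hσ; rcases hσ with rfl | rfl
      exacts [h.sub1, h.sub2]
    exact ⟨τ, by simp, hs.lev L hL⟩

lemma prs_append (τ σ : List (Set X)) : ∀ p ∈ prs (τ ++ σ), p ∈ prs τ ∨ p ∈ prs σ ∨
    (p.1 = tp τ ∧ p.2 = bse σ) := by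
  induction τ with
  | nil => intro p hp; exact Or.inr (Or.inl hp)
  | cons L τ ih =>
    cases τ with
    | nil =>
      cases σ with
      | nil => intro p hp; simp [prs] at hp
      | cons L' σ =>
        intro p hp
        simp only [List.cons_append, List.nil_append, prs, List.mem_cons] at hp
        rcases hp with rfl | hp
        · exact Or.inr (Or.inr ⟨rfl, rfl⟩)
        · exact Or.inr (Or.inl hp)
    | cons L' τ =>
      intro p hp
      simp only [List.cons_append, prs, List.mem_cons] at hp ⊢
      rcases hp with rfl | hp
      · exact Or.inl (Or.inl rfl)
      · rcases ih p hp with h | h | h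
        · exact Or.inl (Or.inr h)
        · exact Or.inr (Or.inl h)
        · exact Or.inr (Or.inr h)

lemma bse_append (τ σ : List (Set X)) (h : τ ≠ []) : bse (τ ++ σ) = bse τ := by
  cases τ with
  | nil => exact absurd rfl h
  | cons L τ => rfl

lemma tp_append (τ σ : List (Set X)) (h : σ ≠ []) : tp (τ ++ σ) = tp σ := by
  induction τ with
  | nil => rfl
  | cons L τ ih =>
    cases τ with
    | nil =>
      cases σ with
      | nil => exact absurd rfl h
      | cons L' σ => rfl
    | cons L' τ => exact ih

lemma ref_stack (τ σ : List (Set X)) (h1 : τ ≠ []) (h2 : σ ≠ []) : Ref [τ, σ] [τ ++ σ] where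
  cnt x := by simp [cnt, ct]
  lk := by
    rintro x y ⟨ρ, hρ, p, hp, hx, hy⟩
    simp at hρ; subst hρ
    rcases prs_append τ σ p hp with h | h | h
    · exact Or.inl ⟨τ, by simp, p, h, hx, hy⟩
    · exact Or.inl ⟨σ, by simp, p, h, hx, hy⟩
    · exact Or.inr ⟨⟨τ, by simp, h.1 ▸ hx⟩, ⟨σ, by simp, h.2 ▸ hy⟩⟩
  bs := by
    rintro x ⟨ρ, hρ, hx⟩
    simp at hρ; subst hρ
    exact ⟨τ, by simp, by rwa [bse_append _ _ h1] at hx⟩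
  tp := by
    rintro x ⟨ρ, hρ, hx⟩
    simp at hρ; subst hρ
    exact ⟨σ, by simp, by rwa [tp_append _ _ h2] at hx⟩
  lev := by
    intro ρ hρ L hL
    simp at hρ; subst hρ
    rcases List.mem_append.1 hL with h | h
    · exact ⟨τ, by simp, L, h, subset_rfl⟩
    · exact ⟨σ, by simp, L, h, subset_rfl⟩

lemma ref_drop (τ : List (Set X)) (h : ∀ L ∈ τ, L = ∅) : Ref [τ] [] where
  cnt x := by
    rw [cnt_cons, cnt_nil]
    simp only [ct, add_zero]
    symm
    rw [List.sum_eq_zero_iff]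
    intro n hn
    obtain ⟨L, hL, rfl⟩ := List.mem_map.1 hn
    simp [h L hL]
  lk := by rintro x y ⟨ρ, hρ, _⟩; simp at hρ
  bs := by rw [Bs_nil]; exact empty_subset _
  tp := by rw [Tp_nil]; exact empty_subset _
  lev := by intro ρ hρ; simp at hρ

def HasVal (f : X → ℤ) (τ : List (Set X)) (n : ℤ) : Prop :=
  ∃ ws : List ℤ, List.Forall₂ (fun L w => ∀ x ∈ L, f x = w) τ ws ∧ ws.sum = n

lemma HasVal.sub {f : X → ℤ} {τ τ' : List (Set X)} {n : ℤ} (h : HasVal f τ n) (hs : SubT τ' τ) :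
    HasVal f τ' n := by
  obtain ⟨ws, h1, h2⟩ := h
  refine ⟨ws, ?_, h2⟩
  clear h2
  induction hs generalizing ws with
  | nil => exact h1
  | cons a b ih =>
    cases h1 with
    | cons c d => exact .cons (fun x hx => c x (a hx)) (ih _ d)

lemma HasVal.append {f : X → ℤ} {τ σ : List (Set X)} {n k : ℤ} (h : HasVal f τ n) (h' : HasVal f σ k) :
    HasVal f (τ ++ σ) (n + k) := by
  obtain ⟨ws, h1, h2⟩ := h
  obtain ⟨ws', h1', h2'⟩ := h'
  exact ⟨ws ++ ws', List.rel_append h1 h1', by simp [h2, h2']⟩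

lemma HasVal.zero (τ : List (Set X)) : HasVal (fun _ => 0) τ 0 := by
  refine ⟨τ.map (fun _ => 0), ?_, by simp⟩
  induction τ with
  | nil => exact .nil
  | cons L τ ih => exact .cons (fun _ _ => rfl) ih

lemma HasVal.neg {f : X → ℤ} {τ : List (Set X)} {n : ℤ} (h : HasVal f τ n) :
    HasVal (fun x => - f x) τ (-n) := by
  obtain ⟨ws, h1, rfl⟩ := h
  induction h1 with
  | nil => exact ⟨[], .nil, by simp⟩
  | @cons L w τ ws a b ih =>
    obtain ⟨vs, h2, h3⟩ := ih
    exact ⟨(-w) :: vs, .cons (fun x hx => by simp [a x hx]) h2, by simp [h3]; ring⟩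

/-- a tower on whose levels `f` is constant has a value -/
lemma exists_hasVal {f : X → ℤ} {τ : List (Set X)} (h : ∀ L ∈ τ, ∃ w, ∀ x ∈ L, f x = w) :
    ∃ n, HasVal f τ n := by
  induction τ with
  | nil => exact ⟨0, [], .nil, by simp⟩
  | cons L τ ih =>
    obtain ⟨n, ws, h1, h2⟩ := ih (fun L hL => h L (List.mem_cons_of_mem _ hL))
    obtain ⟨w, hw⟩ := h L List.mem_cons_self
    exact ⟨_, w :: ws, .cons hw h1, rfl⟩

end PC
set_option linter.unusedSectionVars false
open MeasureTheory Set
open scoped ENNReal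

section PD
variable {X : Type*} [TopologicalSpace X] {I : Type*}

def Eqv (m : I → Set X → ℝ) (A B : Set X) : Prop := ∀ i, m i A = m i B

structure Setup (m : I → Set X → ℝ) : Prop where
  ne : Nonempty I
  add : ∀ i A B, IsClopen A → IsClopen B → Disjoint A B → m i (A ∪ B) = m i A + m i B
  pos : ∀ i A, IsClopen A → A.Nonempty → 0 < m i A
  cmp : ∀ A B, IsClopen A → IsClopen B → (∀ i, m i A < m i B) → ∃ A', A' ⊆ B ∧ IsClopen A' ∧ Eqv m A' A
  cover : ∀ e, IsClopen e → e.Nonempty → ∃ l : List (X ≃ₜ X),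
    (∀ g ∈ l, ∀ A, IsClopen A → Eqv m (g '' A) A) ∧ ∀ x, ∃ g ∈ l, g x ∈ e
  pair : ∀ c, IsClopen c → c.Nonempty → ∃ e e', IsClopen e ∧ IsClopen e' ∧ e.Nonempty ∧ e'.Nonempty ∧
    e ⊆ c ∧ e' ⊆ c ∧ Disjoint e e' ∧ Eqv m e e'

variable {m : I → Set X → ℝ} (S : Setup m)
include S

lemma Setup.empty (i : I) : m i ∅ = 0 := by
  have := S.add i ∅ ∅ isClopen_empty isClopen_empty (by simp)
  simp at this; exact this

lemma Setup.diff (i : I) {A B : Set X} (hA : IsClopen A) (hB : IsClopen B) (h : B ⊆ A) :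
    m i (A \ B) = m i A - m i B := by
  have := S.add i B (A \ B) hB (hA.diff hB) disjoint_sdiff_self_right
  rw [union_sdiff_cancel h] at this
  linarith

lemma Setup.nonneg (i : I) {A : Set X} (hA : IsClopen A) : 0 ≤ m i A := by
  rcases A.eq_empty_or_nonempty with rfl | h
  · rw [S.empty]
  · exact (S.pos i A hA h).le

lemma Setup.eq_empty {A : Set X} (hA : IsClopen A) (h : Eqv m A ∅) : A = ∅ := by
  by_contra hne
  obtain ⟨i⟩ := S.ne
  have := S.pos i A hA (nonempty_iff_ne_empty.2 hne)
  rw [h i, S.empty] at this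
  exact lt_irrefl _ this

lemma Setup.copy {A B A1 : Set X} (hA : IsClopen A) (hB : IsClopen B) (hA1 : IsClopen A1)
    (hs : A1 ⊆ A) (h : Eqv m A B) : ∃ B1, B1 ⊆ B ∧ IsClopen B1 ∧ Eqv m B1 A1 := by
  by_cases he : A1 = A
  · subst he; exact ⟨B, subset_rfl, hB, fun i => (h i).symm⟩
  · refine S.cmp A1 B hA1 hB fun i => ?_
    have h1 := S.diff i hA hA1 hs
    have h2 := S.pos i _ (hA.diff hA1) (sdiff_nonempty.2 fun h => he (hs.antisymm h))
    rw [← h i]; linarith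

omit S in
/-- admissible towers -/
def TOK (m : I → Set X → ℝ) (τ : List (Set X)) : Prop :=
  τ ≠ [] ∧ ∀ L ∈ τ, IsClopen L ∧ Eqv m L (bse τ)

omit S in
lemma TOK.bse {τ : List (Set X)} (h : TOK m τ) : IsClopen (bse τ) := by
  cases τ with
  | nil => exact absurd rfl h.1
  | cons L τ => exact (h.2 L List.mem_cons_self).1

lemma Setup.cutList {A A1 : Set X} (hA : IsClopen A) (hA1 : IsClopen A1) (hs : A1 ⊆ A)
    (σ : List (Set X)) (hσ : ∀ L ∈ σ, IsClopen L ∧ Eqv m L A) :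
    ∃ σ1 σ2, Split σ σ1 σ2 ∧ (∀ L ∈ σ1, IsClopen L ∧ Eqv m L A1) ∧
      (∀ L ∈ σ2, IsClopen L ∧ Eqv m L (A \ A1)) := by
  induction σ with
  | nil => exact ⟨[], [], .nil, by simp, by simp⟩
  | cons L σ ih =>
    obtain ⟨σ1, σ2, h1, h2, h3⟩ := ih fun L hL => hσ L (List.mem_cons_of_mem _ hL)
    obtain ⟨hL, hLA⟩ := hσ L List.mem_cons_self
    obtain ⟨L1, hL1, hc, he⟩ := S.copy hA hL hA1 hs (fun i => (hLA i).symm)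
    refine ⟨L1 :: σ1, (L \ L1) :: σ2, .cons (union_sdiff_cancel hL1).symm disjoint_sdiff_self_right h1, ?_, ?_⟩
    · intro L' hL'
      rcases List.mem_cons.1 hL' with rfl | h
      exacts [⟨hc, he⟩, h2 _ h]
    · intro L' hL'
      rcases List.mem_cons.1 hL' with rfl | h
      · refine ⟨hL.diff hc, fun i => ?_⟩
        rw [S.diff i hL hc hL1, S.diff i hA hA1 hs, he i, hLA i]
      · exact h3 _ h

lemma Setup.cut {τ : List (Set X)} (hτ : TOK m τ) {A1 : Set X} (hA1 : IsClopen A1) (hs : A1 ⊆ bse τ) :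
    ∃ τ1 τ2, Split τ τ1 τ2 ∧ TOK m τ1 ∧ TOK m τ2 ∧ bse τ1 = A1 ∧ bse τ2 = bse τ \ A1 := by
  cases τ with
  | nil => exact absurd rfl hτ.1
  | cons L σ =>
    have hL : IsClopen L := hτ.bse
    obtain ⟨σ1, σ2, h1, h2, h3⟩ := S.cutList hL hA1 hs σ fun L' h => hτ.2 L' (List.mem_cons_of_mem _ h)
    refine ⟨A1 :: σ1, (L \ A1) :: σ2, .cons (union_sdiff_cancel hs).symm disjoint_sdiff_self_right h1,
      ⟨by simp, ?_⟩, ⟨by simp, ?_⟩, rfl, rfl⟩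
    · intro L' hL'
      rcases List.mem_cons.1 hL' with rfl | h
      exacts [⟨hA1, fun _ => rfl⟩, h2 _ h]
    · intro L' hL'
      rcases List.mem_cons.1 hL' with rfl | h
      exacts [⟨hL.diff hA1, fun _ => rfl⟩, h3 _ h]

omit S in
lemma TOK.append {τ σ : List (Set X)} (h : TOK m τ) (h' : TOK m σ) (he : Eqv m (_root_.bse σ) (_root_.bse τ)) :
    TOK m (τ ++ σ) := by
  refine ⟨by simp [h.1], fun L hL => ?_⟩
  rw [bse_append _ _ h.1]
  rcases List.mem_append.1 hL with hL | hL
  · exact h.2 L hL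
  · exact ⟨(h'.2 L hL).1, fun i => ((h'.2 L hL).2 i).trans (he i)⟩

lemma Setup.ref_drop {τ : List (Set X)} (h : TOK m τ) (h0 : bse τ = ∅) : Ref [τ] [] := by
  refine _root_.ref_drop τ fun L hL => S.eq_empty (h.2 L hL).1 (h0 ▸ (h.2 L hL).2)

omit S in
def DOK (m : I → Set X → ℝ) (f : X → ℤ) (E : List (List (Set X) × ℤ)) : Prop :=
  ∀ p ∈ E, TOK m p.1 ∧ HasVal f p.1 p.2

lemma Setup.absorb (f : X → ℤ) (E : List (List (Set X) × ℤ)) : ∀ (r : List (Set X)) (k : ℤ) (x' : Set X),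
    TOK m r → HasVal f r k → DOK m f E → IsClopen x' → x' ⊆ Bs (E.map Prod.fst) → Eqv m (bse r) x' →
    ∃ E1 E2 : List (List (Set X) × ℤ), Ref (r :: E.map Prod.fst) ((E1 ++ E2).map Prod.fst) ∧
      DOK m f E1 ∧ DOK m f E2 ∧ E1.map Prod.snd = E.map (fun p => k + p.2) ∧
      E2.map Prod.snd = E.map Prod.snd ∧ (∀ p ∈ E1, tp p.1 ⊆ tp r) ∧
      Bs (E1.map Prod.fst) = x' ∧ Bs (E1.map Prod.fst) ∪ Bs (E2.map Prod.fst) = Bs (E.map Prod.fst) := by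
  classical
  induction E with
  | nil =>
    intro r k x' hr _ _ _ hx' he
    simp only [List.map_nil, Bs_nil, subset_empty_iff] at hx'
    subst hx'
    refine ⟨[], [], ?_, by simp [DOK], by simp [DOK], rfl, rfl, by simp, by simp [Bs_nil], by simp [Bs_nil]⟩
    exact S.ref_drop hr (S.eq_empty hr.bse he)
  | cons p E ih =>
    obtain ⟨τ, n⟩ := p
    intro r k x' hr hrv hE hx'c hx' he
    obtain ⟨hτ, hτv⟩ := hE _ List.mem_cons_self
    simp only at hτ hτv
    have hA1 : IsClopen (bse τ ∩ x') := hτ.bse.inter hx'c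
    obtain ⟨τ1, τ2, hsp, hτ1, hτ2, hb1, hb2⟩ := S.cut hτ hA1 inter_subset_left
    obtain ⟨R1, hR1, hR1c, hR1e⟩ := S.copy hx'c hr.bse hA1 inter_subset_right (fun i => (he i).symm)
    obtain ⟨r1, r2, hrs, hr1, hr2, hc1, hc2⟩ := S.cut hr hR1c hR1
    have hx2 : x' \ bse τ = x' \ (bse τ ∩ x') := by ext x; simp
    obtain ⟨E1, E2, h1, h2, h3, h4, h5, h6, h7, h8⟩ := ih r2 k (x' \ bse τ) hr2 (hrv.sub hrs.sub2)
      (fun p hp => hE p (List.mem_cons_of_mem _ hp)) (hx'c.diff hτ.bse)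
      (by
        intro x hx
        have := hx' hx.1
        rw [List.map_cons, Bs_cons] at this
        exact this.resolve_left hx.2)
      (by
        intro i
        rw [hc2, S.diff i hr.bse hR1c hR1, hx2, S.diff i hx'c hA1 inter_subset_right, he i, hR1e i])
    refine ⟨(τ1 ++ r1, k + n) :: E1, (τ2, n) :: E2, ?_, ?_, ?_, by simp [h4], by simp [h5], ?_, ?_, ?_⟩
    · have a1 : Ref (r :: τ :: E.map Prod.fst) (([τ] ++ [r]) ++ E.map Prod.fst) :=
        Ref.perm (List.perm_iff_count.2 fun a => by simp [List.count_cons]; omega)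
      have a2 : Ref (([τ] ++ [r]) ++ E.map Prod.fst) (([τ1, τ2] ++ [r1, r2]) ++ E.map Prod.fst) :=
        (hsp.ref.app hrs.ref).app (Ref.refl _)
      have a3 : Ref (([τ1, τ2] ++ [r1, r2]) ++ E.map Prod.fst)
          ([τ1, r1] ++ ([τ2] ++ (r2 :: E.map Prod.fst))) :=
        Ref.perm (List.perm_iff_count.2 fun a => by simp [List.count_cons]; omega)
      have a4 : Ref ([τ1, r1] ++ ([τ2] ++ (r2 :: E.map Prod.fst)))
          ([τ1 ++ r1] ++ ([τ2] ++ ((E1 ++ E2).map Prod.fst))) :=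
        (ref_stack _ _ hτ1.1 hr1.1).app ((Ref.refl _).app h1)
      refine (a1.trans (a2.trans (a3.trans a4))).trans (Ref.perm ?_)
      exact (List.perm_iff_count.2 fun a => by simp [List.count_cons]; omega)
    · intro p hp
      rcases List.mem_cons.1 hp with rfl | hp
      · refine ⟨hτ1.append hr1 ?_, ?_⟩
        · rw [hb1, hc1]; exact hR1e
        · simp only; rw [add_comm]; exact (hτv.sub hsp.sub1).append (hrv.sub hrs.sub1)
      · exact h2 p hp
    · intro p hp
      rcases List.mem_cons.1 hp with rfl | hp
      · exact ⟨hτ2, hτv.sub hsp.sub2⟩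
      · exact h3 p hp
    · intro p hp
      rcases List.mem_cons.1 hp with rfl | hp
      · simp only; rw [tp_append _ _ hr1.1]; exact hrs.sub1.tp
      · exact (h6 p hp).trans hrs.sub2.tp
    · rw [List.map_cons, Bs_cons, h7, bse_append _ _ hτ1.1, hb1]
      ext x; simp; tauto
    · simp only [List.map_cons, Bs_cons]
      rw [← h8, bse_append _ _ hτ1.1, hb1, hb2]
      ext x; simp; tauto

end PD
set_option linter.unusedSectionVars false
set_option linter.unusedVariables false
open MeasureTheory Set
open scoped ENNReal

section PE
variable {X : Type*} [TopologicalSpace X] {I : Type*}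

def Dcd (D L : Set X) : Prop := L ⊆ D ∨ Disjoint L D

lemma Dcd.mono {D L L' : Set X} (h : Dcd D L) (h' : L' ⊆ L) : Dcd D L' := by
  rcases h with h | h
  · exact Or.inl (h'.trans h)
  · exact Or.inr (h.mono_left h')

lemma ct_append (a b : List (Set X)) (x : X) : ct (a ++ b) x = ct a x + ct b x := by simp [ct]

lemma ct_pos {τ : List (Set X)} {x : X} : 1 ≤ ct τ x ↔ ∃ L ∈ τ, x ∈ L := by
  rw [Nat.one_le_iff_ne_zero, Ne, ct, List.sum_eq_zero_iff]
  simp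

lemma bse_mem {τ : List (Set X)} (h : τ ≠ []) : bse τ ∈ τ := by
  cases τ with
  | nil => exact absurd rfl h
  | cons L τ => exact List.mem_cons_self

lemma tp_mem {τ : List (Set X)} (h : τ ≠ []) : tp τ ∈ τ := by
  induction τ with
  | nil => exact absurd rfl h
  | cons L τ ih =>
    cases τ with
    | nil => exact List.mem_cons_self
    | cons L' τ => exact List.mem_cons_of_mem _ (ih (by simp))

lemma ct_bse {τ : List (Set X)} {x : X} (h : x ∈ bse τ) : 1 ≤ ct τ x := by
  cases τ with
  | nil => exact absurd h (by simp [bse])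
  | cons L τ => exact ct_pos.2 ⟨L, List.mem_cons_self, h⟩

lemma cnt_pos {Ξ : List (List (Set X))} {x : X} : 1 ≤ cnt Ξ x ↔ ∃ τ ∈ Ξ, ∃ L ∈ τ, x ∈ L := by
  have : cnt Ξ x = ((Ξ.map fun τ => ct τ x)).sum := rfl
  rw [Nat.one_le_iff_ne_zero, Ne, this, List.sum_eq_zero_iff]
  simp only [List.mem_map, forall_exists_index, and_imp, forall_apply_eq_imp_iff₂, not_forall]
  constructor
  · rintro ⟨τ, h, h'⟩; exact ⟨τ, h, ct_pos.1 (Nat.one_le_iff_ne_zero.2 h')⟩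
  · rintro ⟨τ, h, h'⟩; exact ⟨τ, h, Nat.one_le_iff_ne_zero.1 (ct_pos.2 h')⟩

lemma cnt_Bs {Ξ : List (List (Set X))} {x : X} (h : x ∈ Bs Ξ) : 1 ≤ cnt Ξ x := by
  obtain ⟨τ, hτ, hx⟩ := h
  exact cnt_pos.2 ⟨τ, hτ, ct_pos.1 (ct_bse hx)⟩

variable {m : I → Set X → ℝ}

lemma TOK_of {τ : List (Set X)} {A : Set X} (h : τ ≠ []) (h' : ∀ L ∈ τ, IsClopen L ∧ Eqv m L A) :
    TOK m τ :=
  ⟨h, fun L hL => ⟨(h' L hL).1, fun i => ((h' L hL).2 i).trans ((h' _ (bse_mem h)).2 i).symm⟩⟩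

variable (S : Setup m)
include S

lemma Setup.refine1 {D : Set X} (hD : IsClopen D) (n : ℕ) : ∀ τb τa : List (Set X), τb.length = n →
    TOK m (τa ++ τb) → (∀ L ∈ τa, Dcd D L) →
    ∃ Ts, Ref [τa ++ τb] Ts ∧ (∀ τ ∈ Ts, TOK m τ) ∧ ∀ τ ∈ Ts, ∀ L ∈ τ, Dcd D L := by
  induction n with
  | zero =>
    intro τb τa hn h h'
    obtain rfl := List.length_eq_zero_iff.1 hn
    refine ⟨[τa ++ []], Ref.refl _, by simpa using h, by simpa using h'⟩
  | succ n ih =>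
    intro τb τa hn h h'
    obtain ⟨L, σ, rfl⟩ := List.exists_cons_of_length_eq_add_one hn
    have hσn : σ.length = n := by simpa using hn
    have hmem : L ∈ τa ++ L :: σ := by simp
    have hL : IsClopen L := (h.2 L hmem).1
    have heq : ∀ L' ∈ τa ++ L :: σ, IsClopen L' ∧ Eqv m L' L := fun L' hL' =>
      ⟨(h.2 L' hL').1, fun i => ((h.2 L' hL').2 i).trans ((h.2 L hmem).2 i).symm⟩
    obtain ⟨a1, a2, ha, ha1, ha2⟩ := S.cutList hL (hL.inter hD) inter_subset_left τa
      (fun L' h => heq L' (by simp [h]))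
    obtain ⟨b1, b2, hb, hb1, hb2⟩ := S.cutList hL (hL.inter hD) inter_subset_left σ
      (fun L' h => heq L' (by simp [h]))
    have hsp : Split (τa ++ L :: σ) (a1 ++ (L ∩ D) :: b1) (a2 ++ (L \ (L ∩ D)) :: b2) :=
      ha.append (.cons (union_sdiff_cancel inter_subset_left).symm disjoint_sdiff_self_right hb)
    obtain ⟨T1, r1, o1, d1⟩ := ih b1 (a1 ++ [L ∩ D]) (hb.sub1.length_eq.trans hσn)
      (by
        refine TOK_of (A := L ∩ D) (by simp) ?_
        intro L' hL'
        simp only [List.mem_append, List.mem_singleton] at hL'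
        rcases hL' with (h | rfl) | h
        · exact ha1 _ h
        · exact ⟨hL.inter hD, fun _ => rfl⟩
        · exact hb1 _ h)
      (by
        intro L' hL'
        simp only [List.mem_append, List.mem_singleton] at hL'
        rcases hL' with h | rfl
        · obtain ⟨L2, h2, h3⟩ := ha.sub1.lev L' h
          exact (h' L2 h2).mono h3
        · exact Or.inl inter_subset_right)
    obtain ⟨T2, r2, o2, d2⟩ := ih b2 (a2 ++ [L \ (L ∩ D)]) (hb.sub2.length_eq.trans hσn)
      (by
        refine TOK_of (A := L \ (L ∩ D)) (by simp) ?_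
        intro L' hL'
        simp only [List.mem_append, List.mem_singleton] at hL'
        rcases hL' with (h | rfl) | h
        · exact ha2 _ h
        · exact ⟨hL.diff (hL.inter hD), fun _ => rfl⟩
        · exact hb2 _ h)
      (by
        intro L' hL'
        simp only [List.mem_append, List.mem_singleton] at hL'
        rcases hL' with h | rfl
        · obtain ⟨L2, h2, h3⟩ := ha.sub2.lev L' h
          exact (h' L2 h2).mono h3
        · refine Or.inr (Set.disjoint_left.2 fun x hx hxD => hx.2 ⟨hx.1, hxD⟩))
    refine ⟨T1 ++ T2, ?_, ?_, ?_⟩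
    · refine hsp.ref.trans ?_
      simp only [List.append_assoc, List.singleton_append] at r1 r2
      exact r1.app r2
    · intro τ hτ
      rcases List.mem_append.1 hτ with h | h
      exacts [o1 τ h, o2 τ h]
    · intro τ hτ
      rcases List.mem_append.1 hτ with h | h
      exacts [d1 τ h, d2 τ h]

lemma Setup.refine2 {D : Set X} (hD : IsClopen D) (Ξ : List (List (Set X))) (h : ∀ τ ∈ Ξ, TOK m τ) :
    ∃ Ts, Ref Ξ Ts ∧ (∀ τ ∈ Ts, TOK m τ) ∧ ∀ τ ∈ Ts, ∀ L ∈ τ, Dcd D L := by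
  induction Ξ with
  | nil => exact ⟨[], Ref.refl _, by simp, by simp⟩
  | cons τ Ξ ih =>
    obtain ⟨T1, r1, o1, d1⟩ := S.refine1 hD _ τ [] rfl (h τ List.mem_cons_self) (by simp)
    obtain ⟨T2, r2, o2, d2⟩ := ih fun τ hτ => h τ (List.mem_cons_of_mem _ hτ)
    refine ⟨T1 ++ T2, r1.app r2, ?_, ?_⟩
    · intro τ hτ
      rcases List.mem_append.1 hτ with h | h
      exacts [o1 τ h, o2 τ h]
    · intro τ hτ
      rcases List.mem_append.1 hτ with h | h
      exacts [d1 τ h, d2 τ h]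

omit S in
lemma Ref.dcd {Ξ Ξ' : List (List (Set X))} (h : Ref Ξ Ξ') {D : Set X} (hd : ∀ τ ∈ Ξ, ∀ L ∈ τ, Dcd D L) :
    ∀ τ ∈ Ξ', ∀ L ∈ τ, Dcd D L := by
  intro τ hτ L hL
  obtain ⟨σ, hσ, L', hL', h'⟩ := h.lev τ hτ L hL
  exact (hd σ hσ L' hL').mono h'

lemma Setup.refineAll (Ds : List (Set X)) : ∀ (hD : ∀ D ∈ Ds, IsClopen D) (Ξ : List (List (Set X)))
    (h : ∀ τ ∈ Ξ, TOK m τ),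
    ∃ Ts, Ref Ξ Ts ∧ (∀ τ ∈ Ts, TOK m τ) ∧ ∀ D ∈ Ds, ∀ τ ∈ Ts, ∀ L ∈ τ, Dcd D L := by
  induction Ds with
  | nil => intro _ Ξ h; exact ⟨Ξ, Ref.refl _, h, by simp⟩
  | cons D Ds ih =>
    intro hD Ξ h
    obtain ⟨T1, r1, o1, d1⟩ := S.refine2 (hD D List.mem_cons_self) Ξ h
    obtain ⟨T2, r2, o2, d2⟩ := ih (fun D h => hD D (List.mem_cons_of_mem _ h)) T1 o1
    refine ⟨T2, r1.trans r2, o2, fun D' hD' => ?_⟩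
    rcases List.mem_cons.1 hD' with rfl | h
    exacts [r2.dcd d1, d2 D' h]

lemma Setup.dropAll (Ξ : List (List (Set X))) (h : ∀ τ ∈ Ξ, TOK m τ ∧ bse τ = ∅) : Ref Ξ [] := by
  induction Ξ with
  | nil => exact Ref.refl _
  | cons τ Ξ ih =>
    exact (S.ref_drop (h τ List.mem_cons_self).1 (h τ List.mem_cons_self).2).app
      (ih fun τ hτ => h τ (List.mem_cons_of_mem _ hτ))

/-- undecorated absorption -/
lemma Setup.absorb0 (E : List (List (Set X))) (r : List (Set X)) (x' : Set X) (hr : TOK m r)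
    (hE : ∀ τ ∈ E, TOK m τ) (hx : IsClopen x') (hx' : x' ⊆ Bs E) (he : Eqv m (bse r) x') :
    ∃ E1 E2, Ref (r :: E) (E1 ++ E2) ∧ (∀ τ ∈ E1, TOK m τ) ∧ (∀ τ ∈ E2, TOK m τ) ∧
      (∀ τ ∈ E1, tp τ ⊆ tp r) ∧ Bs E1 = x' ∧ Bs E1 ∪ Bs E2 = Bs E := by
  have hm : (E.map fun τ => (τ, (0 : ℤ))).map Prod.fst = E := by rw [List.map_map]; exact List.map_id _
  obtain ⟨E1, E2, h1, h2, h3, h4, h5, h6, h7, h8⟩ := S.absorb (fun _ => 0) (E.map fun τ => (τ, 0)) r 0 x' hr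
    (HasVal.zero _) (by
      intro p hp
      obtain ⟨τ, hτ, rfl⟩ := List.mem_map.1 hp
      exact ⟨hE τ hτ, HasVal.zero _⟩) hx (by rwa [hm]) he
  rw [hm] at h1 h8
  refine ⟨E1.map Prod.fst, E2.map Prod.fst, by rwa [← List.map_append], ?_, ?_, ?_, h7, h8⟩
  · intro τ hτ
    obtain ⟨p, hp, rfl⟩ := List.mem_map.1 hτ
    exact (h2 p hp).1
  · intro τ hτ
    obtain ⟨p, hp, rfl⟩ := List.mem_map.1 hτ
    exact (h3 p hp).1
  · intro τ hτ
    obtain ⟨p, hp, rfl⟩ := List.mem_map.1 hτ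
    exact h6 p hp

lemma Setup.absorbCover (e : Set X) (he : IsClopen e) (l : List (X ≃ₜ X)) :
    ∀ (E : List (List (Set X))) (r : List (Set X)), (∀ g ∈ l, ∀ A, IsClopen A → Eqv m (g '' A) A) →
    TOK m r → (∀ τ ∈ E, TOK m τ) → Bs E = e → (∀ x ∈ bse r, ∃ g ∈ l, g x ∈ e) →
    ∃ E', Ref (r :: E) E' ∧ (∀ τ ∈ E', TOK m τ) ∧ Bs E' = e := by
  classical
  induction l with
  | nil =>
    intro E r _ hr hE hb hc
    refine ⟨E, ?_, hE, hb⟩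
    exact (S.ref_drop hr (by ext x; simpa using hc x)).app (Ref.refl E)
  | cons g l ih =>
    intro E r hl hr hE hb hc
    have hA : IsClopen (bse r ∩ g ⁻¹' e) := hr.bse.inter (he.preimage g.continuous)
    obtain ⟨r1, r2, hsp, h1, h2, h3, h4⟩ := S.cut hr hA inter_subset_left
    have hgA : IsClopen (g '' (bse r ∩ g ⁻¹' e)) := by
      rw [g.image_eq_preimage_symm]
      exact hA.preimage g.symm.continuous
    obtain ⟨E1, E2, a1, a2, a3, a4, a5, a6⟩ := S.absorb0 E r1 (g '' (bse r ∩ g ⁻¹' e)) h1 hE hgA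
      (by rw [hb]; rintro _ ⟨x, hx, rfl⟩; exact hx.2)
      (by rw [h3]; exact fun i => (hl g List.mem_cons_self _ hA i).symm)
    obtain ⟨E', b1, b2, b3⟩ := ih (E1 ++ E2) r2 (fun g hg => hl g (List.mem_cons_of_mem _ hg)) h2
      (by
        intro τ hτ
        rcases List.mem_append.1 hτ with h | h
        exacts [a2 τ h, a3 τ h])
      (by rw [Bs_append, a6, hb])
      (by
        intro x hx
        rw [h4] at hx
        obtain ⟨g', hg', hx'⟩ := hc x hx.1
        rcases List.mem_cons.1 hg' with rfl | h
        · exact absurd ⟨hx.1, hx'⟩ hx.2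
        · exact ⟨g', h, hx'⟩)
    refine ⟨E', ?_, b2, b3⟩
    have c1 : Ref ([r] ++ E) ([r1, r2] ++ E) := hsp.ref.app (Ref.refl _)
    have c2 : Ref ([r1, r2] ++ E) ([r2] ++ (r1 :: E)) := Ref.perm (List.Perm.swap _ _ _)
    exact (c1.trans c2).trans (((Ref.refl [r2]).app a1).trans b1)

lemma Setup.absorbMany (e : Set X) (he : IsClopen e) (l : List (X ≃ₜ X))
    (hl : ∀ g ∈ l, ∀ A, IsClopen A → Eqv m (g '' A) A) (hc : ∀ x, ∃ g ∈ l, g x ∈ e)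
    (R E : List (List (Set X))) (hR : ∀ τ ∈ R, TOK m τ) (hE : ∀ τ ∈ E, TOK m τ) (hb : Bs E = e) :
    ∃ E', Ref (R ++ E) E' ∧ (∀ τ ∈ E', TOK m τ) ∧ Bs E' = e := by
  induction R with
  | nil => exact ⟨E, Ref.refl _, hE, hb⟩
  | cons r R ih =>
    obtain ⟨E1, h1, h2, h3⟩ := ih fun τ hτ => hR τ (List.mem_cons_of_mem _ hτ)
    obtain ⟨E2, h4, h5, h6⟩ := S.absorbCover e he l E1 r hl (hR r List.mem_cons_self) h2 h3 (fun x _ => hc x)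
    exact ⟨E2, ((Ref.refl [r]).app h1).trans h4, h5, h6⟩

lemma Setup.lev_nonempty {τ : List (Set X)} (h : TOK m τ) {L L' : Set X} (hL : L ∈ τ) (hL' : L' ∈ τ)
    (hn : L.Nonempty) : L'.Nonempty := by
  by_contra hne
  rw [not_nonempty_iff_eq_empty] at hne
  have := S.eq_empty (h.2 L hL).1 (fun i => by rw [← hne, (h.2 L hL).2 i, (h.2 L' hL').2 i])
  exact hn.ne_empty this

lemma Setup.proper [Nonempty X] (Ξ : List (List (Set X))) (hΞ : ∀ τ ∈ Ξ, TOK m τ) (hc : ∀ x, cnt Ξ x = 1) :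
    ∃ Ξ', Ref Ξ Ξ' ∧ (∀ τ ∈ Ξ', TOK m τ) ∧ ∃ τ0 ∈ Ξ, Bs Ξ' ⊆ bse τ0 ∧ Tp Ξ' ⊆ tp τ0 := by
  obtain ⟨x0⟩ := ‹Nonempty X›
  obtain ⟨τ0, hτ0, L, hL, hx0⟩ := cnt_pos.1 (hc x0).ge
  have hT := hΞ τ0 hτ0
  obtain ⟨e, e', he, he', hen, hen', hec, hec', hdis, hee⟩ := S.pair (bse τ0) hT.bse
    (S.lev_nonempty hT hL (bse_mem hT.1) ⟨x0, hx0⟩)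
  obtain ⟨s, t, rfl⟩ := List.append_of_mem hτ0
  obtain ⟨t1, t2, sp1, o1, o2, b1, b2⟩ := S.cut hT he hec
  obtain ⟨t3, t4, sp2, o3, o4, b3, b4⟩ := S.cut o2 he' (by
    rw [b2]; exact fun x hx => ⟨hec' hx, fun h => Set.disjoint_left.1 hdis h hx⟩)
  obtain ⟨l, hl, hcov⟩ := S.cover e he hen
  obtain ⟨E, h1, h2, h3⟩ := S.absorbMany e he l hl hcov (t4 :: (s ++ t)) [t1]
    (by
      intro τ hτ
      simp only [List.mem_cons, List.mem_append] at hτ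
      rcases hτ with rfl | h | h
      · exact o4
      · exact hΞ _ (by simp [h])
      · exact hΞ _ (by simp [h]))
    (by simpa using o1) (by rw [Bs_cons, Bs_nil, b1, union_empty])
  obtain ⟨E1, E2, a1, a2, a3, a4, a5, a6⟩ := S.absorb0 E t3 e o3 h2 he h3.ge (by
    rw [b3]; exact fun i => (hee i).symm)
  have r1 : Ref (s ++ τ0 :: t) ([τ0] ++ (s ++ t)) := Ref.perm List.perm_middle
  have r2 : Ref ([τ0] ++ (s ++ t)) ([t1, t2] ++ (s ++ t)) := sp1.ref.app (Ref.refl _)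
  have r3 : Ref ([t1, t2] ++ (s ++ t)) (([t1] ++ [t3, t4]) ++ (s ++ t)) :=
    ((Ref.refl [t1]).app sp2.ref).app (Ref.refl _)
  have r4 : Ref (([t1] ++ [t3, t4]) ++ (s ++ t)) ([t3] ++ ((t4 :: (s ++ t)) ++ [t1])) := by
    classical
    exact Ref.perm (List.perm_iff_count.2 fun a => by simp [List.count_cons]; omega)
  have r5 : Ref (s ++ τ0 :: t) (E1 ++ E2) :=
    (r1.trans (r2.trans (r3.trans r4))).trans (((Ref.refl [t3]).app h1).trans a1)
  have r6 : Ref E2 [] := S.dropAll E2 fun τ hτ => ⟨a3 τ hτ, by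
    ext x
    simp only [mem_empty_iff_false, iff_false]
    intro hx
    have k0 : x ∈ Bs E2 := ⟨τ, hτ, hx⟩
    have k1 : x ∈ Bs E1 := by rw [a5, ← h3, ← a6]; exact Or.inr k0
    have k2 := r5.cnt x
    rw [hc x, cnt_append] at k2
    have := cnt_Bs k0
    have := cnt_Bs k1
    omega⟩
  have r7 : Ref (E1 ++ E2) E1 := by simpa using (Ref.refl E1).app r6
  refine ⟨E1, r5.trans r7, a2, τ0, by simp, by rw [a5]; exact hec, ?_⟩
  rintro x ⟨τ, hτ, hx⟩
  exact sp1.sub2.tp (sp2.sub1.tp (a4 τ hτ hx))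

end PE
set_option linter.unusedSectionVars false
set_option linter.unusedVariables false
open MeasureTheory Set
open scoped ENNReal

section PF
variable {X : Type*} [TopologicalSpace X] {I : Type*}

lemma sum_inter (μ : Set X → ℝ)
    (add : ∀ A B, IsClopen A → IsClopen B → Disjoint A B → μ (A ∪ B) = μ A + μ B)
    (F : List (Set X)) : ∀ (hF : ∀ L ∈ F, IsClopen L) (A : Set X) (hA : IsClopen A)
    (h : ∀ x ∈ A, ct F x = 1), μ A = (F.map fun L => μ (A ∩ L)).sum := by
  have h0 : μ ∅ = 0 := by
    have := add ∅ ∅ isClopen_empty isClopen_empty (by simp)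
    simp at this; exact this
  induction F with
  | nil =>
    intro _ A _ h
    have : A = ∅ := by ext x; simpa [ct] using h x
    simp [this, h0]
  | cons L F ih =>
    intro hF A hA h
    have hL := hF L List.mem_cons_self
    have h1 := ih (fun L hL => hF L (List.mem_cons_of_mem _ hL)) (A \ L) (hA.diff hL) (by
      intro x hx
      have := h x hx.1
      simpa [ct, hx.2] using this)
    have h2 : ∀ L' ∈ F, (A \ L) ∩ L' = A ∩ L' := by
      intro L' hL'
      ext x
      constructor
      · rintro ⟨a, b⟩; exact ⟨a.1, b⟩
      · rintro ⟨a, b⟩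
        refine ⟨⟨a, fun hx => ?_⟩, b⟩
        have k1 := h x a
        have k2 : 1 ≤ ct F x := ct_pos.2 ⟨L', hL', b⟩
        have k3 : ct (L :: F) x = 1 + ct F x := by simp [ct, hx]
        omega
    rw [List.map_cons, List.sum_cons]
    have h3 : (F.map fun L' => μ ((A \ L) ∩ L')) = F.map fun L' => μ (A ∩ L') :=
      List.map_congr_left fun L' hL' => by rw [h2 L' hL']
    rw [h3] at h1
    rw [← h1, ← add _ _ (hA.inter hL) (hA.diff hL), inter_union_sdiff]
    exact Set.disjoint_left.2 fun x hx hx' => hx'.2 hx.2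

lemma cnt_flatten (Ξ : List (List (Set X))) (x : X) : cnt Ξ x = ct Ξ.flatten x := by
  induction Ξ with
  | nil => simp [cnt, ct]
  | cons τ Ξ ih => rw [cnt_cons, ih, List.flatten_cons, ct_append]

open Classical in
noncomputable def fAA (A A' : Set X) : X → ℤ := fun x => (if x ∈ A then 1 else 0) - (if x ∈ A' then 1 else 0)

lemma fAA_neg (A A' : Set X) : (fun x => - fAA A A' x) = fAA A' A := by
  funext x; simp [fAA]

lemma fAA_const {A A' L : Set X} (h : Dcd A L) (h' : Dcd A' L) : ∃ w, ∀ x ∈ L, fAA A A' x = w := by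
  rcases h with h | h <;> rcases h' with h' | h'
  · exact ⟨0, fun x hx => by simp [fAA, h hx, h' hx]⟩
  · exact ⟨1, fun x hx => by simp [fAA, h hx, Set.disjoint_left.1 h' hx]⟩
  · exact ⟨-1, fun x hx => by simp [fAA, h' hx, Set.disjoint_left.1 h hx]⟩
  · exact ⟨0, fun x hx => by simp [fAA, Set.disjoint_left.1 h' hx, Set.disjoint_left.1 h hx]⟩

lemma level_val (μ : Set X → ℝ) (h0 : μ ∅ = 0) (A A' L : Set X) (w : ℤ) (h : ∀ x ∈ L, fAA A A' x = w) :
    μ (A ∩ L) - μ (A' ∩ L) = w * μ L := by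
  rcases L.eq_empty_or_nonempty with rfl | ⟨x0, hx0⟩
  · simp [h0]
  · have hw := h x0 hx0
    have : w = 0 ∨ w = 1 ∨ w = -1 := by
      rw [← hw]; unfold fAA; split_ifs <;> simp
    rcases this with rfl | rfl | rfl
    · have : A ∩ L = A' ∩ L := by
        ext x
        simp only [mem_inter_iff, and_congr_left_iff]
        intro hx
        have := h x hx
        unfold fAA at this
        split_ifs at this <;> simp_all
      simp [this]
    · have k : ∀ x ∈ L, x ∈ A ∧ x ∉ A' := by
        intro x hx
        have := h x hx
        unfold fAA at this
        split_ifs at this <;> simp_all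
      have k1 : A ∩ L = L := inter_eq_right.2 fun x hx => (k x hx).1
      have k2 : A' ∩ L = ∅ := by ext x; simp; exact fun a b => (k x b).2 a
      simp [k1, k2, h0]
    · have k : ∀ x ∈ L, x ∈ A' ∧ x ∉ A := by
        intro x hx
        have := h x hx
        unfold fAA at this
        split_ifs at this <;> simp_all
      have k1 : A' ∩ L = L := inter_eq_right.2 fun x hx => (k x hx).1
      have k2 : A ∩ L = ∅ := by ext x; simp; exact fun a b => (k x b).2 a
      simp [k1, k2, h0]

lemma tower_val (μ : Set X → ℝ) (h0 : μ ∅ = 0) (A A' : Set X) (τ : List (Set X)) (n : ℤ) (c : ℝ)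
    (hc : ∀ L ∈ τ, μ L = c) (h : HasVal (fAA A A') τ n) :
    (τ.map fun L => μ (A ∩ L)).sum - (τ.map fun L => μ (A' ∩ L)).sum = n * c := by
  obtain ⟨ws, h1, rfl⟩ := h
  induction h1 with
  | nil => simp
  | @cons L w τ ws a b ih =>
    have := ih fun L hL => hc L (List.mem_cons_of_mem _ hL)
    have h2 := level_val μ h0 A A' L w a
    rw [hc L List.mem_cons_self] at h2
    simp only [List.map_cons, List.sum_cons]
    rw [Int.cast_add, add_mul]
    linarith

lemma value_sum (μ : Set X → ℝ)
    (add : ∀ A B, IsClopen A → IsClopen B → Disjoint A B → μ (A ∪ B) = μ A + μ B)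
    (A A' : Set X) (hA : IsClopen A) (hA' : IsClopen A')
    (Φ : List (List (Set X) × ℤ)) (h : ∀ p ∈ Φ, (∀ L ∈ p.1, IsClopen L ∧ μ L = μ (bse p.1)) ∧
      HasVal (fAA A A') p.1 p.2) (hc : ∀ x, cnt (Φ.map Prod.fst) x = 1) :
    μ A - μ A' = (Φ.map fun p => (p.2 : ℝ) * μ (bse p.1)).sum := by
  have h0 : μ ∅ = 0 := by
    have := add ∅ ∅ isClopen_empty isClopen_empty (by simp)
    simp at this; exact this
  have hF : ∀ L ∈ (Φ.map Prod.fst).flatten, IsClopen L := by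
    intro L hL
    obtain ⟨τ, hτ, hL⟩ := List.mem_flatten.1 hL
    obtain ⟨p, hp, rfl⟩ := List.mem_map.1 hτ
    exact ((h p hp).1 L hL).1
  rw [sum_inter μ add _ hF A hA (fun x _ => by rw [← cnt_flatten, hc]),
    sum_inter μ add _ hF A' hA' (fun x _ => by rw [← cnt_flatten, hc])]
  clear hc hF
  induction Φ with
  | nil => simp
  | cons p Φ ih =>
    have := ih fun p hp => h p (List.mem_cons_of_mem _ hp)
    obtain ⟨k1, k2⟩ := h p List.mem_cons_self
    have k3 := tower_val μ h0 A A' p.1 p.2 _ (fun L hL => (k1 L hL).2) k2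
    simp only [List.map_cons, List.flatten_cons, List.map_append, List.sum_append, List.sum_cons]
    linarith

lemma Bs_clopen (Ξ : List (List (Set X))) (h : ∀ τ ∈ Ξ, IsClopen (bse τ)) : IsClopen (Bs Ξ) := by
  induction Ξ with
  | nil => rw [Bs_nil]; exact isClopen_empty
  | cons τ Ξ ih =>
    rw [Bs_cons]
    exact (h τ List.mem_cons_self).union (ih fun τ hτ => h τ (List.mem_cons_of_mem _ hτ))

lemma Bs_sum (μ : Set X → ℝ)
    (add : ∀ A B, IsClopen A → IsClopen B → Disjoint A B → μ (A ∪ B) = μ A + μ B)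
    (Ξ : List (List (Set X))) (h : ∀ τ ∈ Ξ, IsClopen (bse τ)) (hc : ∀ x, cnt Ξ x ≤ 1) :
    μ (Bs Ξ) = (Ξ.map fun τ => μ (bse τ)).sum := by
  induction Ξ with
  | nil =>
    have := add ∅ ∅ isClopen_empty isClopen_empty (by simp)
    simp at this; simp [Bs_nil, this]
  | cons τ Ξ ih =>
    have h2 := ih (fun τ hτ => h τ (List.mem_cons_of_mem _ hτ)) (fun x => by
      have := hc x; rw [cnt_cons] at this; omega)
    rw [Bs_cons, add _ _ (h τ List.mem_cons_self) (Bs_clopen Ξ fun τ hτ => h τ (List.mem_cons_of_mem _ hτ)), h2]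
    · simp
    · refine Set.disjoint_left.2 fun x hx hx' => ?_
      have := hc x
      rw [cnt_cons] at this
      have := ct_bse hx
      have := cnt_Bs hx'
      omega

variable {m : I → Set X → ℝ} (S : Setup m)
include S

lemma Setup.shenPos {A A' : Set X} (hA : IsClopen A) (hA' : IsClopen A') (he : Eqv m A A') (M : ℕ) (hM : 0 < M)
    (Φ : List (List (Set X) × ℤ)) (hΦ : DOK m (fAA A A') Φ) (hc : ∀ x, cnt (Φ.map Prod.fst) x = 1)
    (hb : ∀ p ∈ Φ, |p.2| ≤ M) (r : List (Set X)) (hr : (r, (M : ℤ)) ∈ Φ) :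
    ∃ Φ', DOK m (fAA A A') Φ' ∧ Ref (Φ.map Prod.fst) (Φ'.map Prod.fst) ∧ (∀ p ∈ Φ', |p.2| ≤ M) ∧
      (Φ'.map Prod.snd).countP (fun n => |n| = (M : ℤ)) < (Φ.map Prod.snd).countP (fun n => |n| = (M : ℤ)) := by
  classical
  obtain ⟨s, t, rfl⟩ := List.append_of_mem hr
  set Φ1 := s ++ t with hΦ1
  set N := Φ1.filter (fun p => p.2 < 0) with hN
  set Q := Φ1.filter (fun p => !decide (p.2 < 0)) with hQ
  have hp1 : (s ++ (r, (M : ℤ)) :: t).Perm ((r, (M : ℤ)) :: Φ1) := List.perm_middle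
  have hp2 : (N ++ Q).Perm Φ1 := by
    have := List.filter_append_perm (fun p : List (Set X) × ℤ => decide (p.2 < 0)) Φ1
    exact this
  have hperm : (s ++ (r, (M : ℤ)) :: t).Perm ((r, (M : ℤ)) :: (N ++ Q)) := hp1.trans (hp2.symm.cons _)
  have hmemN : ∀ p ∈ N, p ∈ s ++ (r, (M : ℤ)) :: t := fun p hp => hperm.mem_iff.2 (by simp [hp])
  have hmemQ : ∀ p ∈ Q, p ∈ s ++ (r, (M : ℤ)) :: t := fun p hp => hperm.mem_iff.2 (by simp [hp])
  have hNneg : ∀ p ∈ N, p.2 < 0 := fun p hp => by simpa using (List.mem_filter.1 hp).2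
  have hQnn : ∀ p ∈ Q, 0 ≤ p.2 := fun p hp => by simpa using (List.mem_filter.1 hp).2
  have hrok : TOK m r ∧ HasVal (fAA A A') r M := hΦ _ hr
  have hc2 : ∀ x, ct r x + (cnt (N.map Prod.fst) x + cnt (Q.map Prod.fst) x) = 1 := by
    intro x
    have := (Ref.perm (hperm.map Prod.fst)).cnt x
    rw [hc x, List.map_cons, List.map_append, cnt_cons, cnt_append] at this
    exact this
  set y := Bs (N.map Prod.fst) with hy
  have hNcl : ∀ τ ∈ N.map Prod.fst, IsClopen (bse τ) := by
    intro τ hτ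
    obtain ⟨p, hp, rfl⟩ := List.mem_map.1 hτ
    exact (hΦ p (hmemN p hp)).1.bse
  have hycl : IsClopen y := Bs_clopen _ hNcl
  have key : ∀ i, (M : ℝ) * (m i y - m i (bse r)) =
      (N.map fun p => ((M + p.2 : ℤ) : ℝ) * m i (bse p.1)).sum + (Q.map fun p => (p.2 : ℝ) * m i (bse p.1)).sum := by
    intro i
    have k1 := value_sum (m i) (S.add i) A A' hA hA' _ (fun p hp =>
      ⟨fun L hL => ⟨((hΦ p hp).1.2 L hL).1, ((hΦ p hp).1.2 L hL).2 i⟩, (hΦ p hp).2⟩) hc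
    rw [he i, sub_self, (hperm.map _).sum_eq] at k1
    simp only [List.map_cons, List.sum_cons, List.map_append, List.sum_append] at k1
    have k2 : m i y = (N.map fun p => m i (bse p.1)).sum := by
      rw [hy, Bs_sum (m i) (S.add i) _ hNcl (fun x => by have := hc2 x; omega), List.map_map]; rfl
    have k3 : (N.map fun p => ((M + p.2 : ℤ) : ℝ) * m i (bse p.1)).sum =
        M * (N.map fun p => m i (bse p.1)).sum + (N.map fun p => (p.2 : ℝ) * m i (bse p.1)).sum := by
      rw [← List.sum_map_mul_left, ← List.sum_map_add]
      congr 1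
      refine List.map_congr_left fun p _ => ?_
      push_cast; ring
    rw [k3, k2]
    push_cast at k1
    linarith
  have hMr : (0 : ℝ) < M := by exact_mod_cast hM
  have tN : ∀ i, ∀ p ∈ N, 0 ≤ ((M + p.2 : ℤ) : ℝ) * m i (bse p.1) := by
    intro i p hp
    have := abs_le.1 (hb p (hmemN p hp))
    exact mul_nonneg (by exact_mod_cast (by linarith [this.1])) (S.nonneg i (hΦ p (hmemN p hp)).1.bse)
  have tQ : ∀ i, ∀ p ∈ Q, 0 ≤ (p.2 : ℝ) * m i (bse p.1) := by
    intro i p hp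
    exact mul_nonneg (by exact_mod_cast hQnn p hp) (S.nonneg i (hΦ p (hmemQ p hp)).1.bse)
  have hx : ∃ x', x' ⊆ y ∧ IsClopen x' ∧ Eqv m x' (bse r) := by
    by_cases hex : (∃ p ∈ N, M + p.2 ≠ 0 ∧ (bse p.1).Nonempty) ∨ (∃ p ∈ Q, p.2 ≠ 0 ∧ (bse p.1).Nonempty)
    · refine S.cmp _ _ hrok.1.bse hycl fun i => ?_
      have : 0 < (M : ℝ) * (m i y - m i (bse r)) := by
        rw [key i]
        have n1 : 0 ≤ (N.map fun p => ((M + p.2 : ℤ) : ℝ) * m i (bse p.1)).sum :=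
          List.sum_nonneg (by
            intro z hz; obtain ⟨p, hp, rfl⟩ := List.mem_map.1 hz; exact tN i p hp)
        have n2 : 0 ≤ (Q.map fun p => (p.2 : ℝ) * m i (bse p.1)).sum :=
          List.sum_nonneg (by
            intro z hz; obtain ⟨p, hp, rfl⟩ := List.mem_map.1 hz; exact tQ i p hp)
        rcases hex with ⟨p, hp, h1, h2⟩ | ⟨p, hp, h1, h2⟩
        · have h3 : ((M + p.2 : ℤ) : ℝ) * m i (bse p.1) ≠ 0 :=
            mul_ne_zero (by exact_mod_cast h1) (S.pos i _ (hΦ p (hmemN p hp)).1.bse h2).ne'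
          have h4 := List.single_le_sum (l := N.map fun p => ((M + p.2 : ℤ) : ℝ) * m i (bse p.1)) (by
            intro z hz; obtain ⟨p, hp, rfl⟩ := List.mem_map.1 hz; exact tN i p hp) _
            (List.mem_map.2 ⟨p, hp, rfl⟩)
          have h5 := (tN i p hp).lt_of_ne h3.symm
          linarith
        · have h3 : (p.2 : ℝ) * m i (bse p.1) ≠ 0 :=
            mul_ne_zero (by exact_mod_cast h1) (S.pos i _ (hΦ p (hmemQ p hp)).1.bse h2).ne'
          have h4 := List.single_le_sum (l := Q.map fun p => (p.2 : ℝ) * m i (bse p.1)) (by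
            intro z hz; obtain ⟨p, hp, rfl⟩ := List.mem_map.1 hz; exact tQ i p hp) _
            (List.mem_map.2 ⟨p, hp, rfl⟩)
          have h5 := (tQ i p hp).lt_of_ne h3.symm
          linarith
      have := (mul_pos_iff_of_pos_left hMr).1 this
      linarith
    · push Not at hex
      refine ⟨y, subset_rfl, hycl, fun i => ?_⟩
      have n1 : (N.map fun p => ((M + p.2 : ℤ) : ℝ) * m i (bse p.1)).sum = 0 :=
        List.sum_eq_zero (by
          intro z hz; obtain ⟨p, hp, rfl⟩ := List.mem_map.1 hz
          by_cases h : M + p.2 = 0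
          · simp only [h]; simp
          · simp only [hex.1 p hp h, S.empty]; simp)
      have n2 : (Q.map fun p => (p.2 : ℝ) * m i (bse p.1)).sum = 0 :=
        List.sum_eq_zero (by
          intro z hz; obtain ⟨p, hp, rfl⟩ := List.mem_map.1 hz
          by_cases h : p.2 = 0
          · simp only [h]; simp
          · simp only [hex.2 p hp h, S.empty]; simp)
      have := key i
      rw [n1, n2, add_zero] at this
      have := (mul_eq_zero.1 this).resolve_left hMr.ne'
      linarith
  obtain ⟨x', hx1, hx2, hx3⟩ := hx
  obtain ⟨E1, E2, h1, h2, h3, h4, h5, -, -, -⟩ := S.absorb (fAA A A') N r M x' hrok.1 hrok.2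
    (fun p hp => hΦ p (hmemN p hp)) hx2 hx1 (fun i => (hx3 i).symm)
  have m1 : ∀ p ∈ E1, ∃ q ∈ N, p.2 = M + q.2 := by
    intro p hp
    have : p.2 ∈ E1.map Prod.snd := List.mem_map.2 ⟨p, hp, rfl⟩
    rw [h4] at this
    obtain ⟨q, hq, h⟩ := List.mem_map.1 this
    exact ⟨q, hq, h.symm⟩
  have m2 : ∀ p ∈ E2, ∃ q ∈ N, p.2 = q.2 := by
    intro p hp
    have : p.2 ∈ E2.map Prod.snd := List.mem_map.2 ⟨p, hp, rfl⟩
    rw [h5] at this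
    obtain ⟨q, hq, h⟩ := List.mem_map.1 this
    exact ⟨q, hq, h.symm⟩
  refine ⟨(E1 ++ E2) ++ Q, ?_, ?_, ?_, ?_⟩
  · intro p hp
    simp only [List.mem_append] at hp
    rcases hp with (hp | hp) | hp
    exacts [h2 p hp, h3 p hp, hΦ p (hmemQ p hp)]
  · refine (Ref.perm (hperm.map Prod.fst)).trans ?_
    have := h1.app (Ref.refl (Q.map Prod.fst))
    simpa using this
  · intro p hp
    simp only [List.mem_append] at hp
    rcases hp with (hp | hp) | hp
    · obtain ⟨q, hq, h⟩ := m1 p hp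
      have := abs_le.1 (hb q (hmemN q hq))
      have := hNneg q hq
      rw [h, abs_le]; omega
    · obtain ⟨q, hq, h⟩ := m2 p hp
      rw [h]; exact hb q (hmemN q hq)
    · exact hb p (hmemQ p hp)
  · have e1 : (E1.map Prod.snd).countP (fun n => |n| = (M : ℤ)) = 0 := by
      rw [List.countP_eq_zero]
      intro n hn
      obtain ⟨p, hp, rfl⟩ := List.mem_map.1 hn
      obtain ⟨q, hq, h⟩ := m1 p hp
      have := abs_le.1 (hb q (hmemN q hq))
      have := hNneg q hq
      rw [h, abs_of_nonneg (by omega)]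
      simp; omega
    have e2 := (hperm.map Prod.snd).countP_eq (fun n => decide (|n| = (M : ℤ)))
    rw [e2]
    simp only [List.map_append, List.countP_append, List.map_cons, List.countP_cons]
    rw [e1, h5]
    simp

lemma Setup.shenStep {A A' : Set X} (hA : IsClopen A) (hA' : IsClopen A') (he : Eqv m A A') (M : ℕ) (hM : 0 < M)
    (Φ : List (List (Set X) × ℤ)) (hΦ : DOK m (fAA A A') Φ) (hc : ∀ x, cnt (Φ.map Prod.fst) x = 1)
    (hb : ∀ p ∈ Φ, |p.2| ≤ M) (hr : ∃ p ∈ Φ, |p.2| = M) :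
    ∃ Φ', DOK m (fAA A A') Φ' ∧ Ref (Φ.map Prod.fst) (Φ'.map Prod.fst) ∧ (∀ p ∈ Φ', |p.2| ≤ M) ∧
      (Φ'.map Prod.snd).countP (fun n => |n| = (M : ℤ)) < (Φ.map Prod.snd).countP (fun n => |n| = (M : ℤ)) := by
  obtain ⟨⟨r, n⟩, hp, hn⟩ := hr
  simp only at hn
  rcases (abs_eq (by positivity)).1 hn with rfl | rfl
  · exact S.shenPos hA hA' he M hM Φ hΦ hc hb r hp
  · have neg : ∀ (B B' : Set X) (Ψ : List (List (Set X) × ℤ)), DOK m (fAA B B') Ψ →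
        DOK m (fAA B' B) (Ψ.map fun p => (p.1, -p.2)) := by
      intro B B' Ψ h p hp
      obtain ⟨q, hq, rfl⟩ := List.mem_map.1 hp
      refine ⟨(h q hq).1, ?_⟩
      rw [← fAA_neg]
      exact (h q hq).2.neg
    have fst : ∀ Ψ : List (List (Set X) × ℤ), (Ψ.map fun p => (p.1, -p.2)).map Prod.fst = Ψ.map Prod.fst := by
      intro Ψ; rw [List.map_map]; rfl
    have cp : ∀ Ψ : List (List (Set X) × ℤ), ((Ψ.map fun p => (p.1, -p.2)).map Prod.snd).countP
        (fun n => |n| = (M : ℤ)) = (Ψ.map Prod.snd).countP (fun n => |n| = (M : ℤ)) := by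
      intro Ψ; rw [List.map_map, List.countP_map, List.countP_map]; congr 1; funext p; simp
    have bd : ∀ Ψ : List (List (Set X) × ℤ), (∀ p ∈ Ψ, |p.2| ≤ M) →
        ∀ p ∈ (Ψ.map fun p : List (Set X) × ℤ => (p.1, -p.2)), |p.2| ≤ (M : ℤ) := by
      intro Ψ h p hp
      obtain ⟨q, hq, rfl⟩ := List.mem_map.1 hp
      simpa using h q hq
    obtain ⟨Φ', h1, h2, h3, h4⟩ := S.shenPos hA' hA (fun i => (he i).symm) M hM
      (Φ.map fun p => (p.1, -p.2)) (neg _ _ _ hΦ) (by rwa [fst]) (bd _ hb) r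
      (List.mem_map.2 ⟨_, hp, by simp⟩)
    refine ⟨Φ'.map fun p => (p.1, -p.2), neg _ _ _ h1, ?_, bd _ h3, ?_⟩
    · rw [fst] at h2 ⊢; exact h2
    · rw [cp] at h4 ⊢; exact h4

lemma Setup.shen {A A' : Set X} (hA : IsClopen A) (hA' : IsClopen A') (he : Eqv m A A') (M : ℕ) :
    ∀ (Φ : List (List (Set X) × ℤ)), DOK m (fAA A A') Φ → (∀ x, cnt (Φ.map Prod.fst) x = 1) →
    (∀ p ∈ Φ, |p.2| ≤ M) →
    ∃ Φ', DOK m (fAA A A') Φ' ∧ Ref (Φ.map Prod.fst) (Φ'.map Prod.fst) ∧ (∀ p ∈ Φ', p.2 = 0) := by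
  induction M with
  | zero =>
    intro Φ hΦ hc hb
    exact ⟨Φ, hΦ, Ref.refl _, fun p hp => by simpa using hb p hp⟩
  | succ M ih =>
    have : ∀ c : ℕ, ∀ (Φ : List (List (Set X) × ℤ)), (Φ.map Prod.snd).countP (fun n => |n| = ((M + 1 : ℕ) : ℤ)) = c →
        DOK m (fAA A A') Φ → (∀ x, cnt (Φ.map Prod.fst) x = 1) → (∀ p ∈ Φ, |p.2| ≤ (M + 1 : ℕ)) →
        ∃ Φ', DOK m (fAA A A') Φ' ∧ Ref (Φ.map Prod.fst) (Φ'.map Prod.fst) ∧ (∀ p ∈ Φ', p.2 = 0) := by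
      intro c
      induction c using Nat.strong_induction_on with
      | _ c ihc =>
        intro Φ hcp hΦ hc hb
        by_cases hr : ∃ p ∈ Φ, |p.2| = (M + 1 : ℕ)
        · obtain ⟨Φ', h1, h2, h3, h4⟩ := S.shenStep hA hA' he (M + 1) (by omega) Φ hΦ hc hb hr
          rw [hcp] at h4
          obtain ⟨Φ2, k1, k2, k3⟩ := ihc _ h4 Φ' rfl h1 (fun x => by rw [h2.cnt, hc]) h3
          exact ⟨Φ2, k1, h2.trans k2, k3⟩
        · push Not at hr
          refine ih Φ hΦ hc fun p hp => ?_
          have := lt_of_le_of_ne (hb p hp) (hr p hp)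
          push_cast at this
          omega
    intro Φ hΦ hc hb
    exact this _ Φ rfl hΦ hc hb

lemma exists_deco (f : X → ℤ) (Ξ : List (List (Set X))) (h : ∀ τ ∈ Ξ, TOK m τ)
    (hf : ∀ τ ∈ Ξ, ∀ L ∈ τ, ∃ w, ∀ x ∈ L, f x = w) :
    ∃ Φ, DOK m f Φ ∧ Φ.map Prod.fst = Ξ ∧ ∃ M : ℕ, ∀ p ∈ Φ, |p.2| ≤ M := by
  induction Ξ with
  | nil => exact ⟨[], by simp [DOK], rfl, 0, by simp⟩
  | cons τ Ξ ih =>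
    obtain ⟨Φ, h1, h2, M, hM⟩ := ih (fun τ hτ => h τ (List.mem_cons_of_mem _ hτ))
      (fun τ hτ => hf τ (List.mem_cons_of_mem _ hτ))
    obtain ⟨n, hn⟩ := exists_hasVal (hf τ List.mem_cons_self)
    refine ⟨(τ, n) :: Φ, ?_, by simp [h2], max M n.natAbs, ?_⟩
    · intro p hp
      rcases List.mem_cons.1 hp with rfl | hp
      exacts [⟨h τ List.mem_cons_self, hn⟩, h1 p hp]
    · intro p hp
      rcases List.mem_cons.1 hp with rfl | hp
      · rw [Int.abs_eq_natAbs]; exact_mod_cast le_max_right _ _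
      · exact (hM p hp).trans (by exact_mod_cast le_max_left _ _)

lemma Setup.step [Nonempty X] (Ξ : List (List (Set X))) (hΞ : ∀ τ ∈ Ξ, TOK m τ) (hc : ∀ x, cnt Ξ x = 1)
    (Ds : List (Set X)) (hDs : ∀ D ∈ Ds, IsClopen D) (A A' : Set X) (hA : IsClopen A) (hA' : IsClopen A')
    (he : Eqv m A A') :
    ∃ Ξ', Ref Ξ Ξ' ∧ (∀ τ ∈ Ξ', TOK m τ) ∧ (∀ D ∈ Ds, ∀ τ ∈ Ξ', ∀ L ∈ τ, Dcd D L) ∧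
      (∀ D ∈ Ds, Dcd D (Bs Ξ') ∧ Dcd D (Tp Ξ')) ∧ ∀ τ ∈ Ξ', HasVal (fAA A A') τ 0 := by
  obtain ⟨Ξ1, r1, o1, d1⟩ := S.refineAll (A :: A' :: Ds) (by
    intro D hD
    simp only [List.mem_cons] at hD
    rcases hD with rfl | rfl | h
    exacts [hA, hA', hDs D h]) Ξ hΞ
  have c1 : ∀ x, cnt Ξ1 x = 1 := fun x => by rw [r1.cnt, hc]
  obtain ⟨Ξ2, r2, o2, τ0, hτ0, hb, ht⟩ := S.proper Ξ1 o1 c1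
  have c2 : ∀ x, cnt Ξ2 x = 1 := fun x => by rw [r2.cnt, c1]
  have d2 : ∀ D ∈ (A :: A' :: Ds), ∀ τ ∈ Ξ2, ∀ L ∈ τ, Dcd D L := fun D hD => r2.dcd (d1 D hD)
  obtain ⟨Φ, h1, h2, M, hM⟩ := exists_deco S (fAA A A') Ξ2 o2 (fun τ hτ L hL =>
    fAA_const (d2 A (by simp) τ hτ L hL) (d2 A' (by simp) τ hτ L hL))
  obtain ⟨Φ', k1, k2, k3⟩ := S.shen hA hA' he M Φ h1 (by rwa [h2]) hM
  rw [h2] at k2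
  refine ⟨Φ'.map Prod.fst, r1.trans (r2.trans k2), ?_, ?_, ?_, ?_⟩
  · intro τ hτ
    obtain ⟨p, hp, rfl⟩ := List.mem_map.1 hτ
    exact (k1 p hp).1
  · intro D hD
    exact k2.dcd (d2 D (by simp [hD]))
  · intro D hD
    exact ⟨(d1 D (by simp [hD]) τ0 hτ0 _ (bse_mem (o1 τ0 hτ0).1)).mono (k2.bs.trans hb),
      (d1 D (by simp [hD]) τ0 hτ0 _ (tp_mem (o1 τ0 hτ0).1)).mono (k2.tp.trans ht)⟩
  · intro τ hτ
    obtain ⟨p, hp, rfl⟩ := List.mem_map.1 hτ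
    have := (k1 p hp).2
    rwa [k3 p hp] at this

end PF
set_option linter.unusedSectionVars false
set_option linter.unusedVariables false
open MeasureTheory Set
open scoped ENNReal

section PG

def ag (n : ℕ) (x y : Cantor) : Prop := ∀ i < n, x i = y i

lemma ag.symm {n : ℕ} {x y : Cantor} (h : ag n x y) : ag n y x := fun i hi => (h i hi).symm

lemma eq_of_ag {x y : Cantor} (h : ∀ n, ag n x y) : x = y := by
  funext i; exact h (i + 1) i (Nat.lt_succ_self i)

lemma clopen_det (A : Set Cantor) (hA : IsClopen A) : ∃ n, ∀ x y, ag n x y → x ∈ A → y ∈ A := by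
  by_contra hcon
  push Not at hcon
  let K : ℕ → Set (Cantor × Cantor) := fun n => {p | (∀ i < n, p.1 i = p.2 i) ∧ p.1 ∈ A ∧ p.2 ∉ A}
  have hcl : ∀ n, IsClosed (K n) := by
    intro n
    have h1 : IsClosed {p : Cantor × Cantor | ∀ i < n, p.1 i = p.2 i} := by
      have : {p : Cantor × Cantor | ∀ i < n, p.1 i = p.2 i} = ⋂ i, ⋂ (_ : i < n), {p | p.1 i = p.2 i} := by
        ext p; simp
      rw [this]
      exact isClosed_iInter fun i => isClosed_iInter fun _ => isClosed_eq (by fun_prop) (by fun_prop)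
    have h2 : IsClosed {p : Cantor × Cantor | p.1 ∈ A} := hA.isClosed.preimage continuous_fst
    have h3 : IsClosed {p : Cantor × Cantor | p.2 ∉ A} := hA.compl.isClosed.preimage continuous_snd
    exact h1.inter (h2.inter h3)
  obtain ⟨p, hp⟩ := IsCompact.nonempty_iInter_of_sequence_nonempty_isCompact_isClosed K
    (fun n p hp => ⟨fun i hi => hp.1 i (by omega), hp.2⟩)
    (fun n => by
      obtain ⟨x, y, h1, h2, h3⟩ := hcon n
      exact ⟨(x, y), h1, h2, h3⟩) (hcl 0).isCompact hcl
  rw [mem_iInter] at hp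
  have : p.1 = p.2 := eq_of_ag fun n => (hp n).1
  exact (hp 0).2.2 (this ▸ (hp 0).2.1)

lemma limit_fun (R : ℕ → Cantor → Cantor → Prop) (anti : ∀ n x y, R (n + 1) x y → R n x y)
    (h1 : ∀ n x, IsClopen {y | R n x y} ∧ {y | R n x y}.Nonempty ∧ ∀ y y', R n x y → R n x y' → ag n y y') :
    ∃ t : Cantor → Cantor, (∀ n x, R n x (t x)) ∧ ∀ x y, (∀ n, R n x y) → y = t x := by
  have : ∀ x, ∃ y, ∀ n, R n x y := by
    intro x
    obtain ⟨y, hy⟩ := IsCompact.nonempty_iInter_of_sequence_nonempty_isCompact_isClosed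
      (fun n => {y | R n x y}) (fun n y hy => anti n x y hy) (fun n => (h1 n x).2.1)
      (h1 0 x).1.isClosed.isCompact (fun n => (h1 n x).1.isClosed)
    exact ⟨y, fun n => (mem_iInter.1 hy n)⟩
  choose t ht using this
  exact ⟨t, fun n x => ht x n, fun x y hy => eq_of_ag fun n => (h1 n x).2.2 _ _ (hy n) (ht x n)⟩

lemma limit_cont (R : ℕ → Cantor → Cantor → Prop)
    (h1 : ∀ n x, IsClopen {y | R n x y} ∧ {y | R n x y}.Nonempty ∧ ∀ y y', R n x y → R n x y' → ag n y y')
    (h2 : ∀ n y, IsClopen {x | R n x y})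
    (t : Cantor → Cantor) (ht : ∀ n x, R n x (t x)) : Continuous t := by
  refine continuous_pi fun i => ?_
  rw [continuous_iff_continuousAt]
  intro x
  have : (fun x' => t x' i) =ᶠ[nhds x] fun _ => t x i := by
    filter_upwards [(h2 (i + 1) (t x)).isOpen.mem_nhds (ht (i + 1) x)] with x' hx'
    exact (h1 (i + 1) x').2.2 _ _ (ht _ _) hx' i (Nat.lt_succ_self i)
  exact (continuousAt_const (y := t x i)).congr this.symm

lemma limit_homeo (R : ℕ → Cantor → Cantor → Prop) (anti : ∀ n x y, R (n + 1) x y → R n x y)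
    (h1 : ∀ n x, IsClopen {y | R n x y} ∧ {y | R n x y}.Nonempty ∧ ∀ y y', R n x y → R n x y' → ag n y y')
    (h2 : ∀ n y, IsClopen {x | R n x y} ∧ {x | R n x y}.Nonempty ∧ ∀ x x', R n x y → R n x' y → ag n x x') :
    ∃ T : Cantor ≃ₜ Cantor, ∀ n x, R n x (T x) := by
  obtain ⟨t, ht, hu⟩ := limit_fun R anti h1
  obtain ⟨t', ht', hu'⟩ := limit_fun (fun n y x => R n x y) (fun n y x => anti n x y) h2
  exact ⟨{ toFun := t
           invFun := t'
           left_inv := fun x => (hu' (t x) x fun n => ht n x).symm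
           right_inv := fun y => (hu (t' y) y fun n => ht' n y).symm
           continuous_toFun := limit_cont R h1 (fun n y => (h2 n y).1) t ht
           continuous_invFun := limit_cont (fun n y x => R n x y) h2 (fun n x => (h1 n x).1) t' ht' },
    fun n x => ht n x⟩

end PG

section PG2
variable {X : Type*} [TopologicalSpace X] {I : Type*}

def PP (Ξ : List (List (Set X))) : List (Set X × Set X) := Ξ.flatMap prs

lemma mem_PP {Ξ : List (List (Set X))} {p : Set X × Set X} : p ∈ PP Ξ ↔ ∃ τ ∈ Ξ, p ∈ prs τ := by
  simp [PP]

lemma ct_fst (τ : List (Set X)) (h : τ ≠ []) (x : X) : ct τ x = ct [tp τ] x + ct ((prs τ).map Prod.fst) x := by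
  induction τ with
  | nil => exact absurd rfl h
  | cons L τ ih =>
    cases τ with
    | nil => simp [tp, prs, ct]
    | cons L' τ =>
      have := ih (by simp)
      simp only [tp, prs, ct, List.map_cons, List.sum_cons] at this ⊢
      omega

lemma ct_snd (τ : List (Set X)) (h : τ ≠ []) (x : X) : ct τ x = ct [bse τ] x + ct ((prs τ).map Prod.snd) x := by
  induction τ with
  | nil => exact absurd rfl h
  | cons L τ ih =>
    cases τ with
    | nil => simp [bse, prs, ct]
    | cons L' τ =>
      have := ih (by simp)
      simp only [bse, prs, ct, List.map_cons, List.sum_cons, List.map_nil, List.sum_nil] at this ⊢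
      omega

lemma cnt_fst (Ξ : List (List (Set X))) (h : ∀ τ ∈ Ξ, τ ≠ []) (x : X) :
    cnt Ξ x = ct (Ξ.map tp ++ (PP Ξ).map Prod.fst) x := by
  induction Ξ with
  | nil => simp [cnt, PP, ct]
  | cons τ Ξ ih =>
    have h1 := ih fun τ hτ => h τ (List.mem_cons_of_mem _ hτ)
    have h2 := ct_fst τ (h τ List.mem_cons_self) x
    rw [cnt_cons, h1, h2]
    simp only [PP, ct, List.map_cons, List.flatMap_cons, List.map_append, List.sum_append, List.sum_cons,
      List.map_nil, List.sum_nil, List.cons_append]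
    omega

lemma cnt_snd (Ξ : List (List (Set X))) (h : ∀ τ ∈ Ξ, τ ≠ []) (x : X) :
    cnt Ξ x = ct (Ξ.map bse ++ (PP Ξ).map Prod.snd) x := by
  induction Ξ with
  | nil => simp [cnt, PP, ct]
  | cons τ Ξ ih =>
    have h1 := ih fun τ hτ => h τ (List.mem_cons_of_mem _ hτ)
    have h2 := ct_snd τ (h τ List.mem_cons_self) x
    rw [cnt_cons, h1, h2]
    simp only [PP, ct, List.map_cons, List.flatMap_cons, List.map_append, List.sum_append, List.sum_cons,
      List.map_nil, List.sum_nil, List.cons_append]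
    omega

lemma ct_uniq {α : Type*} (l : List α) (φ : α → Set X) (x : X) (h : ct (l.map φ) x ≤ 1) {a b : α}
    (ha : a ∈ l) (hb : b ∈ l) (hxa : x ∈ φ a) (hxb : x ∈ φ b) : a = b := by
  induction l with
  | nil => simp at ha
  | cons c l ih =>
    have hc : ct ((c :: l).map φ) x = ct [φ c] x + ct (l.map φ) x := by simp [ct]
    rw [hc] at h
    rcases List.mem_cons.1 ha with rfl | ha' <;> rcases List.mem_cons.1 hb with rfl | hb'
    · rfl
    · have k1 : 1 ≤ ct [φ a] x := ct_pos.2 ⟨_, by simp, hxa⟩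
      have k2 : 1 ≤ ct (l.map φ) x := ct_pos.2 ⟨_, List.mem_map.2 ⟨b, hb', rfl⟩, hxb⟩
      omega
    · have k1 : 1 ≤ ct [φ b] x := ct_pos.2 ⟨_, by simp, hxb⟩
      have k2 : 1 ≤ ct (l.map φ) x := ct_pos.2 ⟨_, List.mem_map.2 ⟨a, ha', rfl⟩, hxa⟩
      omega
    · exact ih (by omega) ha' hb'

structure Good (Ξ : List (List (Set X))) : Prop where
  ne : ∀ τ ∈ Ξ, τ ≠ []
  cnt : ∀ x, cnt Ξ x = 1

lemma Lk_iff (Ξ : List (List (Set X))) (x y : X) : Lk Ξ x y ↔ ∃ p ∈ PP Ξ, x ∈ p.1 ∧ y ∈ p.2 := by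
  simp only [Lk, mem_PP]; grind

lemma Good.cases1 {Ξ : List (List (Set X))} (h : Good Ξ) (x : X) : x ∈ Tp Ξ ∨ ∃ p ∈ PP Ξ, x ∈ p.1 := by
  have := h.cnt x
  rw [cnt_fst Ξ h.ne, ct_append] at this
  by_cases h0 : 1 ≤ ct (Ξ.map tp) x
  · obtain ⟨L, hL, hx⟩ := ct_pos.1 h0
    obtain ⟨τ, hτ, rfl⟩ := List.mem_map.1 hL
    exact Or.inl ⟨τ, hτ, hx⟩
  · have : 1 ≤ ct ((PP Ξ).map Prod.fst) x := by omega
    obtain ⟨L, hL, hx⟩ := ct_pos.1 this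
    obtain ⟨p, hp, rfl⟩ := List.mem_map.1 hL
    exact Or.inr ⟨p, hp, hx⟩

lemma Good.cases2 {Ξ : List (List (Set X))} (h : Good Ξ) (x : X) : x ∈ Bs Ξ ∨ ∃ p ∈ PP Ξ, x ∈ p.2 := by
  have := h.cnt x
  rw [cnt_snd Ξ h.ne, ct_append] at this
  by_cases h0 : 1 ≤ ct (Ξ.map bse) x
  · obtain ⟨L, hL, hx⟩ := ct_pos.1 h0
    obtain ⟨τ, hτ, rfl⟩ := List.mem_map.1 hL
    exact Or.inl ⟨τ, hτ, hx⟩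
  · have : 1 ≤ ct ((PP Ξ).map Prod.snd) x := by omega
    obtain ⟨L, hL, hx⟩ := ct_pos.1 this
    obtain ⟨p, hp, rfl⟩ := List.mem_map.1 hL
    exact Or.inr ⟨p, hp, hx⟩

lemma Good.disj1 {Ξ : List (List (Set X))} (h : Good Ξ) {x : X} (hx : x ∈ Tp Ξ) {p : Set X × Set X}
    (hp : p ∈ PP Ξ) (hxp : x ∈ p.1) : False := by
  have := h.cnt x
  rw [cnt_fst Ξ h.ne, ct_append] at this
  obtain ⟨τ, hτ, hx⟩ := hx
  have k1 : 1 ≤ ct (Ξ.map tp) x := ct_pos.2 ⟨_, List.mem_map.2 ⟨τ, hτ, rfl⟩, hx⟩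
  have k2 : 1 ≤ ct ((PP Ξ).map Prod.fst) x := ct_pos.2 ⟨_, List.mem_map.2 ⟨p, hp, rfl⟩, hxp⟩
  omega

lemma Good.disj2 {Ξ : List (List (Set X))} (h : Good Ξ) {x : X} (hx : x ∈ Bs Ξ) {p : Set X × Set X}
    (hp : p ∈ PP Ξ) (hxp : x ∈ p.2) : False := by
  have := h.cnt x
  rw [cnt_snd Ξ h.ne, ct_append] at this
  obtain ⟨τ, hτ, hx⟩ := hx
  have k1 : 1 ≤ ct (Ξ.map bse) x := ct_pos.2 ⟨_, List.mem_map.2 ⟨τ, hτ, rfl⟩, hx⟩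
  have k2 : 1 ≤ ct ((PP Ξ).map Prod.snd) x := ct_pos.2 ⟨_, List.mem_map.2 ⟨p, hp, rfl⟩, hxp⟩
  omega

lemma Good.uniq1 {Ξ : List (List (Set X))} (h : Good Ξ) {x : X} {p q : Set X × Set X}
    (hp : p ∈ PP Ξ) (hq : q ∈ PP Ξ) (hxp : x ∈ p.1) (hxq : x ∈ q.1) : p = q := by
  have := h.cnt x
  rw [cnt_fst Ξ h.ne, ct_append] at this
  exact ct_uniq (PP Ξ) Prod.fst x (by omega) hp hq hxp hxq

lemma Good.uniq2 {Ξ : List (List (Set X))} (h : Good Ξ) {x : X} {p q : Set X × Set X}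
    (hp : p ∈ PP Ξ) (hq : q ∈ PP Ξ) (hxp : x ∈ p.2) (hxq : x ∈ q.2) : p = q := by
  have := h.cnt x
  rw [cnt_snd Ξ h.ne, ct_append] at this
  exact ct_uniq (PP Ξ) Prod.snd x (by omega) hp hq hxp hxq

lemma Good.rl_tp {Ξ : List (List (Set X))} (h : Good Ξ) {x y : X} (hx : x ∈ Tp Ξ) :
    Rl Ξ x y ↔ y ∈ Bs Ξ := by
  refine ⟨?_, fun hy => Or.inr ⟨hx, hy⟩⟩
  rintro (h1 | h1)
  · obtain ⟨p, hp, hxp, _⟩ := (Lk_iff _ _ _).1 h1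
    exact (h.disj1 hx hp hxp).elim
  · exact h1.2

lemma Good.rl_bs {Ξ : List (List (Set X))} (h : Good Ξ) {x y : X} (hy : y ∈ Bs Ξ) :
    Rl Ξ x y ↔ x ∈ Tp Ξ := by
  refine ⟨?_, fun hx => Or.inr ⟨hx, hy⟩⟩
  rintro (h1 | h1)
  · obtain ⟨p, hp, _, hyp⟩ := (Lk_iff _ _ _).1 h1
    exact (h.disj2 hy hp hyp).elim
  · exact h1.1

lemma Good.rl_fst {Ξ : List (List (Set X))} (h : Good Ξ) {x y : X} {p : Set X × Set X} (hp : p ∈ PP Ξ)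
    (hx : x ∈ p.1) : Rl Ξ x y ↔ y ∈ p.2 := by
  refine ⟨?_, fun hy => Or.inl ((Lk_iff _ _ _).2 ⟨p, hp, hx, hy⟩)⟩
  rintro (h1 | h1)
  · obtain ⟨q, hq, hxq, hyq⟩ := (Lk_iff _ _ _).1 h1
    rwa [h.uniq1 hp hq hx hxq]
  · exact (h.disj1 h1.1 hp hx).elim

lemma Good.rl_snd {Ξ : List (List (Set X))} (h : Good Ξ) {x y : X} {p : Set X × Set X} (hp : p ∈ PP Ξ)
    (hy : y ∈ p.2) : Rl Ξ x y ↔ x ∈ p.1 := by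
  refine ⟨?_, fun hx => Or.inl ((Lk_iff _ _ _).2 ⟨p, hp, hx, hy⟩)⟩
  rintro (h1 | h1)
  · obtain ⟨q, hq, hxq, hyq⟩ := (Lk_iff _ _ _).1 h1
    rwa [h.uniq2 hp hq hy hyq]
  · exact (h.disj2 h1.2 hp hy).elim

lemma prs_mem {τ : List (Set X)} {p : Set X × Set X} (h : p ∈ prs τ) : p.1 ∈ τ ∧ p.2 ∈ τ := by
  induction τ with
  | nil => simp [prs] at h
  | cons L τ ih =>
    cases τ with
    | nil => simp [prs] at h
    | cons L' τ =>
      simp only [prs, List.mem_cons] at h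
      rcases h with rfl | h
      · simp
      · exact ⟨List.mem_cons_of_mem _ (ih h).1, List.mem_cons_of_mem _ (ih h).2⟩

lemma eq_of_prs (μ : Set X → ℝ) {τ : List (Set X)} (h : ∀ p ∈ prs τ, μ p.1 = μ p.2) :
    ∀ L ∈ τ, μ L = μ (bse τ) := by
  induction τ with
  | nil => simp
  | cons L τ ih =>
    cases τ with
    | nil => simp [bse]
    | cons L' τ =>
      intro L2 hL2
      rcases List.mem_cons.1 hL2 with rfl | hL2
      · rfl
      · rw [ih (fun p hp => h p (List.mem_cons_of_mem _ hp)) L2 hL2]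
        exact (h (L, L') List.mem_cons_self).symm

lemma Tp_clopen (Ξ : List (List (Set X))) (h : ∀ τ ∈ Ξ, IsClopen (tp τ)) : IsClopen (Tp Ξ) := by
  induction Ξ with
  | nil => rw [Tp_nil]; exact isClopen_empty
  | cons τ Ξ ih =>
    rw [Tp_cons]
    exact (h τ List.mem_cons_self).union (ih fun τ hτ => h τ (List.mem_cons_of_mem _ hτ))

end PG2
set_option linter.unusedSectionVars false
set_option linter.unusedVariables false
open MeasureTheory Set
open scoped ENNReal

section PH
variable {I : Type*}

def coordList (n : ℕ) : List (Set Cantor) := (List.range n).map fun i => {x | x i = true}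

lemma coordList_clopen (n : ℕ) : ∀ D ∈ coordList n, IsClopen D := by
  intro D hD
  obtain ⟨i, _, rfl⟩ := List.mem_map.1 hD
  exact (isClopen_discrete {true}).preimage (continuous_apply i)

lemma ag_of_dcd {n : ℕ} {L : Set Cantor} (h : ∀ D ∈ coordList n, Dcd D L) {x y : Cantor} (hx : x ∈ L)
    (hy : y ∈ L) : ag n x y := by
  intro i hi
  rcases h {x | x i = true} (List.mem_map.2 ⟨i, List.mem_range.2 hi, rfl⟩) with h | h
  · rw [show x i = true from h hx, show y i = true from h hy]
  · have h1 : ¬ x i = true := Set.disjoint_left.1 h hx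
    have h2 : ¬ y i = true := Set.disjoint_left.1 h hy
    simp at h1 h2
    rw [h1, h2]

variable {m : I → Set Cantor → ℝ} (S : Setup m)
include S

lemma Setup.seq (P : ℕ → Set Cantor × Set Cantor)
    (hP : ∀ n, IsClopen (P n).1 ∧ IsClopen (P n).2 ∧ Eqv m (P n).1 (P n).2) :
    ∃ Ξ : ℕ → List (List (Set Cantor)), (∀ n, Ref (Ξ n) (Ξ (n + 1))) ∧ (∀ n, ∀ τ ∈ Ξ n, TOK m τ) ∧
      (∀ n, Good (Ξ n)) ∧ (∀ n, ∀ τ ∈ Ξ n, ∀ L ∈ τ, ∀ x ∈ L, ∀ y ∈ L, ag n x y) ∧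
      (∀ n, ∀ x ∈ Bs (Ξ n), ∀ y ∈ Bs (Ξ n), ag n x y) ∧
      (∀ n, ∀ x ∈ Tp (Ξ n), ∀ y ∈ Tp (Ξ n), ag n x y) ∧
      ∀ n, ∀ τ ∈ Ξ (n + 1), HasVal (fAA (P n).1 (P n).2) τ 0 := by
  let Q := {Ξ : List (List (Set Cantor)) // (∀ τ ∈ Ξ, TOK m τ) ∧ ∀ x, cnt Ξ x = 1}
  have hstep : ∀ (n : ℕ) (q : Q), ∃ q' : Q, Ref q.1 q'.1 ∧
      (∀ D ∈ coordList (n + 1), ∀ τ ∈ q'.1, ∀ L ∈ τ, Dcd D L) ∧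
      (∀ D ∈ coordList (n + 1), Dcd D (Bs q'.1) ∧ Dcd D (Tp q'.1)) ∧
      ∀ τ ∈ q'.1, HasVal (fAA (P n).1 (P n).2) τ 0 := by
    intro n q
    obtain ⟨Ξ', h1, h2, h3, h4, h5⟩ := S.step q.1 q.2.1 q.2.2 (coordList (n + 1)) (coordList_clopen _)
      (P n).1 (P n).2 (hP n).1 (hP n).2.1 (hP n).2.2
    exact ⟨⟨Ξ', h2, fun x => by rw [h1.cnt, q.2.2]⟩, h1, h3, h4, h5⟩
  choose nx hnx using hstep
  let q0 : Q := ⟨[[univ]], by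
    intro τ hτ
    simp at hτ
    subst hτ
    refine ⟨by simp, fun L hL => ?_⟩
    simp at hL
    subst hL
    exact ⟨isClopen_univ, fun _ => rfl⟩, fun x => by simp [cnt, ct]⟩
  let q : ℕ → Q := fun n => Nat.rec q0 (fun n q => nx n q) n
  have hq : ∀ n, q (n + 1) = nx n (q n) := fun n => rfl
  refine ⟨fun n => (q n).1, ?_, fun n => (q n).2.1, fun n => ⟨fun τ hτ => ((q n).2.1 τ hτ).1, (q n).2.2⟩,
    ?_, ?_, ?_, ?_⟩
  · intro n; simp only [hq]; exact (hnx n (q n)).1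
  · intro n
    cases n with
    | zero => intro τ _ L _ x _ y _ i hi; omega
    | succ n =>
      intro τ hτ L hL x hx y hy
      simp only [hq] at hτ
      exact ag_of_dcd (fun D hD => (hnx n (q n)).2.1 D hD τ hτ L hL) hx hy
  · intro n
    cases n with
    | zero => intro x _ y _ i hi; omega
    | succ n =>
      intro x hx y hy
      simp only [hq] at hx hy
      exact ag_of_dcd (fun D hD => ((hnx n (q n)).2.2.1 D hD).1) hx hy
  · intro n
    cases n with
    | zero => intro x _ y _ i hi; omega
    | succ n =>
      intro x hx y hy
      simp only [hq] at hx hy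
      exact ag_of_dcd (fun D hD => ((hnx n (q n)).2.2.1 D hD).2) hx hy
  · intro n τ hτ
    simp only [hq] at hτ
    exact (hnx n (q n)).2.2.2 τ hτ

theorem Setup.tower_limit (P : ℕ → Set Cantor × Set Cantor)
    (hP : ∀ n, IsClopen (P n).1 ∧ IsClopen (P n).2 ∧ Eqv m (P n).1 (P n).2) :
    ∃ T : Cantor ≃ₜ Cantor, (∀ i A, IsClopen A → m i (T ⁻¹' A) = m i A) ∧
      ∀ ν : Set Cantor → ℝ, (∀ A B, IsClopen A → IsClopen B → Disjoint A B → ν (A ∪ B) = ν A + ν B) →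
        (∀ A, IsClopen A → ν (T ⁻¹' A) = ν A) → ∀ n, ν (P n).1 = ν (P n).2 := by
  obtain ⟨Ξ, hR, hT, hG, hl, hbs, htp, hv⟩ := S.seq P hP
  have hne : ∀ n, (Bs (Ξ n)).Nonempty ∧ (Tp (Ξ n)).Nonempty := by
    intro n
    obtain ⟨τ, hτ, L, hL, hx⟩ := cnt_pos.1 ((hG n).cnt (fun _ => false)).ge
    obtain ⟨b, hb⟩ := S.lev_nonempty (hT n τ hτ) hL (bse_mem (hT n τ hτ).1) ⟨_, hx⟩
    obtain ⟨c, hc⟩ := S.lev_nonempty (hT n τ hτ) hL (tp_mem (hT n τ hτ).1) ⟨_, hx⟩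
    exact ⟨⟨b, τ, hτ, hb⟩, ⟨c, τ, hτ, hc⟩⟩
  have hbc : ∀ n, IsClopen (Bs (Ξ n)) := fun n => Bs_clopen _ fun τ hτ => (hT n τ hτ).bse
  have htc : ∀ n, IsClopen (Tp (Ξ n)) := fun n => Tp_clopen _ fun τ hτ =>
    ((hT n τ hτ).2 _ (tp_mem (hT n τ hτ).1)).1
  have hpc : ∀ n, ∀ p ∈ PP (Ξ n), ∃ τ ∈ Ξ n, p ∈ prs τ ∧ p.1 ∈ τ ∧ p.2 ∈ τ ∧ IsClopen p.1 ∧ IsClopen p.2 := by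
    intro n p hp
    obtain ⟨τ, hτ, hp⟩ := mem_PP.1 hp
    obtain ⟨a, b⟩ := prs_mem hp
    exact ⟨τ, hτ, hp, a, b, ((hT n τ hτ).2 _ a).1, ((hT n τ hτ).2 _ b).1⟩
  obtain ⟨T, hTr⟩ := limit_homeo (fun n => Rl (Ξ n)) (fun n x y h => (hR n).rl h)
    (by
      intro n x
      rcases (hG n).cases1 x with h | ⟨p, hp, h⟩
      · have : {y | Rl (Ξ n) x y} = Bs (Ξ n) := by ext y; exact (hG n).rl_tp h
        refine ⟨this ▸ hbc n, this ▸ (hne n).1, fun y y' hy hy' => ?_⟩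
        exact hbs n _ (((hG n).rl_tp h).1 hy) _ (((hG n).rl_tp h).1 hy')
      · obtain ⟨τ, hτ, _, h1, h2, c1, c2⟩ := hpc n p hp
        have : {y | Rl (Ξ n) x y} = p.2 := by ext y; exact (hG n).rl_fst hp h
        refine ⟨this ▸ c2, this ▸ S.lev_nonempty (hT n τ hτ) h1 h2 ⟨x, h⟩, fun y y' hy hy' => ?_⟩
        exact hl n τ hτ _ h2 _ (((hG n).rl_fst hp h).1 hy) _ (((hG n).rl_fst hp h).1 hy'))
    (by
      intro n x
      rcases (hG n).cases2 x with h | ⟨p, hp, h⟩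
      · have : {y | Rl (Ξ n) y x} = Tp (Ξ n) := by ext y; exact (hG n).rl_bs h
        refine ⟨this ▸ htc n, this ▸ (hne n).2, fun y y' hy hy' => ?_⟩
        exact htp n _ (((hG n).rl_bs h).1 hy) _ (((hG n).rl_bs h).1 hy')
      · obtain ⟨τ, hτ, _, h1, h2, c1, c2⟩ := hpc n p hp
        have : {y | Rl (Ξ n) y x} = p.1 := by ext y; exact (hG n).rl_snd hp h
        refine ⟨this ▸ c1, this ▸ S.lev_nonempty (hT n τ hτ) h2 h1 ⟨x, h⟩, fun y y' hy hy' => ?_⟩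
        exact hl n τ hτ _ h1 _ (((hG n).rl_snd hp h).1 hy) _ (((hG n).rl_snd hp h).1 hy'))
  have hpre : ∀ n, ∀ p ∈ PP (Ξ n), T ⁻¹' p.2 = p.1 := by
    intro n p hp
    ext x
    exact ⟨fun h => ((hG n).rl_snd hp h).1 (hTr n x), fun h => ((hG n).rl_fst hp h).1 (hTr n x)⟩
  refine ⟨T, ?_, ?_⟩
  · intro i A hA
    obtain ⟨n, hn⟩ := clopen_det A hA
    have hdec : ∀ L : Set Cantor, (∀ x ∈ L, ∀ y ∈ L, ag n x y) → Dcd A L := by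
      intro L hL
      by_cases h : ∃ x ∈ L, x ∈ A
      · obtain ⟨x, hx, hxA⟩ := h
        exact Or.inl fun y hy => hn x y (hL x hx y hy) hxA
      · push Not at h
        exact Or.inr (Set.disjoint_left.2 h)
    have e1 := sum_inter (m i) (S.add i) ((Ξ n).map tp ++ (PP (Ξ n)).map Prod.fst) (by
      intro L hL
      rcases List.mem_append.1 hL with h | h
      · obtain ⟨τ, hτ, rfl⟩ := List.mem_map.1 h
        exact ((hT n τ hτ).2 _ (tp_mem (hT n τ hτ).1)).1
      · obtain ⟨p, hp, rfl⟩ := List.mem_map.1 h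
        obtain ⟨τ, hτ, _, h1, h2, c1, c2⟩ := hpc n p hp
        exact c1) (T ⁻¹' A) (hA.preimage T.continuous) (fun x _ => by
          rw [← cnt_fst _ (hG n).ne, (hG n).cnt])
    have e2 := sum_inter (m i) (S.add i) ((Ξ n).map bse ++ (PP (Ξ n)).map Prod.snd) (by
      intro L hL
      rcases List.mem_append.1 hL with h | h
      · obtain ⟨τ, hτ, rfl⟩ := List.mem_map.1 h
        exact (hT n τ hτ).bse
      · obtain ⟨p, hp, rfl⟩ := List.mem_map.1 h
        obtain ⟨τ, hτ, _, h1, h2, c1, c2⟩ := hpc n p hp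
        exact c2) A hA (fun x _ => by
          rw [← cnt_snd _ (hG n).ne, (hG n).cnt])
    rw [e1, e2]
    simp only [List.map_append, List.map_map, List.sum_append]
    congr 2
    · refine List.map_congr_left fun τ hτ => ?_
      simp only [Function.comp]
      have hsub : ∀ x ∈ tp τ, T x ∈ Bs (Ξ n) := fun x hx => ((hG n).rl_tp ⟨τ, hτ, hx⟩).1 (hTr n x)
      rcases hdec (Bs (Ξ n)) (hbs n) with h | h
      · rw [inter_eq_right.2 (show tp τ ⊆ T ⁻¹' A from fun x hx => h (hsub x hx)), inter_eq_right.2 (fun x hx => h ⟨τ, hτ, hx⟩)]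
        exact ((hT n τ hτ).2 _ (tp_mem (hT n τ hτ).1)).2 i
      · have k1 : T ⁻¹' A ∩ tp τ = ∅ := by
          ext x; simp only [mem_inter_iff, mem_empty_iff_false, iff_false]
          exact fun hx => Set.disjoint_left.1 h (hsub x hx.2) hx.1
        have k2 : A ∩ bse τ = ∅ := by
          ext x; simp only [mem_inter_iff, mem_empty_iff_false, iff_false]
          exact fun hx => Set.disjoint_left.1 h ⟨τ, hτ, hx.2⟩ hx.1
        rw [k1, k2]
    · refine List.map_congr_left fun p hp => ?_
      simp only [Function.comp]
      obtain ⟨τ, hτ, _, h1, h2, c1, c2⟩ := hpc n p hp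
      rw [← hpre n p hp, ← preimage_inter]
      rcases hdec p.2 (hl n τ hτ _ h2) with h | h
      · rw [inter_eq_right.2 h, hpre n p hp, ((hT n τ hτ).2 _ h1).2 i, ((hT n τ hτ).2 _ h2).2 i]
      · rw [h.symm.inter_eq]; simp
  · intro ν add hν n
    have hc : ∀ x, cnt (((Ξ (n + 1)).map fun τ => (τ, (0 : ℤ))).map Prod.fst) x = 1 := by
      intro x
      rw [List.map_map]
      have : (Ξ (n + 1)).map (Prod.fst ∘ fun τ => (τ, (0 : ℤ))) = Ξ (n + 1) := List.map_id _
      rw [this, (hG (n + 1)).cnt]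
    have := value_sum ν add (P n).1 (P n).2 (hP n).1 (hP n).2.1 ((Ξ (n + 1)).map fun τ => (τ, 0)) (by
      intro p hp
      obtain ⟨τ, hτ, rfl⟩ := List.mem_map.1 hp
      refine ⟨fun L hL => ⟨((hT _ τ hτ).2 L hL).1, ?_⟩, hv n τ hτ⟩
      refine eq_of_prs ν (fun p hp => ?_) L hL
      have hpp : p ∈ PP (Ξ (n + 1)) := mem_PP.2 ⟨τ, hτ, hp⟩
      rw [← hpre (n + 1) p hpp]
      exact hν _ ((hT _ τ hτ).2 _ (prs_mem hp).2).1) hc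
    have h0 : (((Ξ (n + 1)).map fun τ => (τ, (0 : ℤ))).map fun p => (p.2 : ℝ) * ν (bse p.1)).sum = 0 := by
      refine List.sum_eq_zero fun z hz => ?_
      obtain ⟨p, hp, rfl⟩ := List.mem_map.1 hz
      obtain ⟨τ, hτ, rfl⟩ := List.mem_map.1 hp
      simp
    rw [h0] at this
    linarith

end PH
set_option linter.unusedSectionVars false
set_option linter.unusedVariables false
open MeasureTheory Set
open scoped ENNReal

section PI
variable {Γ : Type*} [Group Γ] {X : Type*} [TopologicalSpace X] [CompactSpace X] [T2Space X]
  [TotallyDisconnectedSpace X]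

lemma min_hit (α : Γ →* X ≃ₜ X) (hmin : IsMinimalAction α) (U : Set X) (hU : IsOpen U)
    (hn : U.Nonempty) (x : X) : ∃ γ, α γ x ∈ U := by
  have h := hmin (⋃ γ, α γ ⁻¹' U)ᶜ
    (isOpen_iUnion fun γ => hU.preimage (α γ).continuous).isClosed_compl (by
      rintro δ _ ⟨y, hy, rfl⟩ hc
      apply hy
      obtain ⟨γ, hγ⟩ := mem_iUnion.1 hc
      refine mem_iUnion.2 ⟨γ * δ, ?_⟩
      rw [map_mul]; exact hγ)
  rcases h with h | h
  · have : x ∈ ⋃ γ, α γ ⁻¹' U := by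
      rw [compl_empty_iff] at h; rw [h]; trivial
    exact mem_iUnion.1 this
  · exfalso
    obtain ⟨y, hy⟩ := hn
    have : y ∈ (⋃ γ, α γ ⁻¹' U)ᶜ := by rw [h]; trivial
    apply this
    refine mem_iUnion.2 ⟨1, ?_⟩
    rw [map_one]; exact hy

variable [MeasurableSpace X] [BorelSpace X]

lemma exists_inv_of_amen [SecondCountableTopology X] [Nonempty X] (hamen : ∃ m : Set Γ → ℝ, IsInvFapm m)
    (α : Γ →* X ≃ₜ X) :
    ∃ μ : Measure X, IsProbabilityMeasure μ ∧ ∀ γ, Measure.map (α γ) μ = μ := by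
  obtain ⟨m, h0, h1, hu, hadd, hinv⟩ := hamen
  obtain ⟨x⟩ := ‹Nonempty X›
  obtain ⟨μ, hp, hμ⟩ := exists_measure_of_finadd (fun A : Set X => m {γ | α γ x ∈ A})
    (fun A _ => h0 _) (by simpa using hu) (by
      intro A B _ _ hd
      have : {γ | α γ x ∈ A ∪ B} = {γ | α γ x ∈ A} ∪ {γ | α γ x ∈ B} := rfl
      simp only [this]
      refine hadd _ _ (Set.disjoint_left.2 fun γ h h' => Set.disjoint_left.1 hd h h'))
  refine ⟨μ, hp, fun γ => ?_⟩
  apply map_eq_of_clopen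
  intro A hA
  rw [hμ A hA, hμ _ (hA.preimage (α γ).continuous)]
  congr 1
  rw [← hinv γ]
  congr 1
  ext δ
  constructor
  · rintro ⟨ε, hε, rfl⟩
    change α (γ * ε) x ∈ A
    rw [map_mul]; exact hε
  · intro h
    refine ⟨γ⁻¹ * δ, ?_, by simp⟩
    change α γ (α (γ⁻¹ * δ) x) ∈ A
    have : α γ (α (γ⁻¹ * δ) x) = α (γ * (γ⁻¹ * δ)) x := by rw [map_mul α γ]; rfl
    rw [this]; simpa using h

lemma image_meas (μ : Measure X) (g : X ≃ₜ X) (h : Measure.map g μ = μ) (A : Set X) (hA : IsClopen A) :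
    IsClopen (g '' A) ∧ μ (g '' A) = μ A := by
  have hc : IsClopen (g '' A) := by
    rw [g.image_eq_preimage_symm]; exact hA.preimage g.symm.continuous
  refine ⟨hc, ?_⟩
  rw [← measure_preimage_of_map μ g h _ hc, preimage_image_eq _ g.injective]

lemma min_pos [Countable Γ] (α : Γ →* X ≃ₜ X) (hmin : IsMinimalAction α) (μ : Measure X)
    [IsProbabilityMeasure μ] (hμ : ∀ γ, Measure.map (α γ) μ = μ) (A : Set X) (hA : IsClopen A)
    (hn : A.Nonempty) : μ A ≠ 0 := by
  intro h0
  have hu : (⋃ γ, α γ ⁻¹' A) = univ := eq_univ_of_forall fun x =>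
    mem_iUnion.2 (min_hit α hmin A hA.isOpen hn x)
  have : μ univ = 0 := by
    rw [← hu, measure_iUnion_null_iff]
    intro γ
    rw [measure_preimage_of_map μ _ (hμ γ) A hA, h0]
  simp at this

lemma setup_of [SecondCountableTopology X] [Nonempty X] [Countable Γ]
    (hamen : ∃ m : Set Γ → ℝ, IsInvFapm m) (α : Γ →* X ≃ₜ X) (hmin : IsMinimalAction α)
    (hperf : ∀ c : Set X, IsOpen c → ∀ x ∈ c, ∃ y ∈ c, y ≠ x)
    (hcmp : ∀ A B : Set X, IsClopen A → IsClopen B →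
        (∀ μ : Measure X, IsProbabilityMeasure μ → (∀ γ, Measure.map (α γ) μ = μ) → μ A < μ B) →
        ∃ (n : ℕ) (P : Fin n → Set X) (g : Fin n → X ≃ₜ X),
          (∀ i, ∀ μ : Measure X, IsProbabilityMeasure μ → (∀ γ, Measure.map (α γ) μ = μ) →
            Measure.map ⇑(g i) μ = μ) ∧
          (∀ i, IsClopen (P i)) ∧
          (Pairwise fun i j => Disjoint (P i) (P j)) ∧
          (⋃ i, P i) = A ∧
          (Pairwise fun i j => Disjoint (⇑(g i) '' P i) (⇑(g j) '' P j)) ∧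
          ∀ i, ⇑(g i) '' P i ⊆ B) :
    Setup (fun (i : {μ : Measure X // IsProbabilityMeasure μ ∧ ∀ γ, Measure.map (α γ) μ = μ})
      (A : Set X) => (i.1 A).toReal) where
  ne := by
    obtain ⟨μ, h⟩ := exists_inv_of_amen hamen α
    exact ⟨⟨μ, h⟩⟩
  add := by
    rintro ⟨μ, hp, hμ⟩ A B hA hB hd
    simp only
    rw [measure_union hd hB.isOpen.measurableSet, ENNReal.toReal_add (measure_ne_top _ _) (measure_ne_top _ _)]
  pos := by
    rintro ⟨μ, hp, hμ⟩ A hA hn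
    exact ENNReal.toReal_pos (min_pos α hmin μ hμ A hA hn) (measure_ne_top _ _)
  cmp := by
    intro A B hA hB h
    obtain ⟨n, P, g, hg, hP, hd, hU, hgd, hB'⟩ := hcmp A B hA hB (by
      intro μ hp hμ
      have := h ⟨μ, hp, hμ⟩
      exact (ENNReal.toReal_lt_toReal (measure_ne_top _ _) (measure_ne_top _ _)).1 this)
    obtain ⟨μ₀, hp₀, hμ₀⟩ := exists_inv_of_amen hamen α
    have hc : ∀ i, IsClopen (g i '' P i) := fun i => (image_meas μ₀ (g i) (hg i μ₀ hp₀ hμ₀) _ (hP i)).1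
    refine ⟨⋃ i, g i '' P i, iUnion_subset hB', isClopen_iUnion_of_finite hc, ?_⟩
    rintro ⟨μ, hp, hμ⟩
    simp only
    congr 1
    rw [← hU, measure_iUnion hgd (fun i => (hc i).isOpen.measurableSet),
      measure_iUnion hd (fun i => (hP i).isOpen.measurableSet)]
    exact tsum_congr fun i => (image_meas μ (g i) (hg i μ hp hμ) _ (hP i)).2
  cover := by
    intro e he hn
    obtain ⟨t, ht⟩ := isCompact_univ.elim_finite_subcover (fun γ => α γ ⁻¹' e)
      (fun γ => he.isOpen.preimage (α γ).continuous)
      (fun x _ => mem_iUnion.2 (min_hit α hmin e he.isOpen hn x))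
    refine ⟨t.toList.map α, ?_, ?_⟩
    · intro g hg A hA
      obtain ⟨γ, _, rfl⟩ := List.mem_map.1 hg
      rintro ⟨μ, hp, hμ⟩
      simp only
      rw [(image_meas μ _ (hμ γ) A hA).2]
    · intro x
      obtain ⟨γ, hγ, hx⟩ := mem_iUnion₂.1 (ht (mem_univ x))
      exact ⟨α γ, List.mem_map.2 ⟨γ, Finset.mem_toList.2 hγ, rfl⟩, hx⟩
  pair := by
    intro c hc hn
    obtain ⟨x, hx⟩ := hn
    obtain ⟨y, hy, hyx⟩ := hperf c hc.isOpen x hx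
    obtain ⟨γ, hγ⟩ := min_hit α hmin (c \ {x}) (hc.isOpen.sdiff isClosed_singleton) ⟨y, hy, hyx⟩ x
    obtain ⟨D, hD, hxD, hyD⟩ := exists_isClopen_of_totally_separated (fun h => hγ.2 h.symm : x ≠ α γ x)
    have hcl : IsClopen (c ∩ D ∩ α γ ⁻¹' (c ∩ Dᶜ)) :=
      (hc.inter hD).inter ((hc.inter hD.compl).preimage (α γ).continuous)
    obtain ⟨μ₀, hp₀, hμ₀⟩ := exists_inv_of_amen hamen α
    have hxm : x ∈ c ∩ D ∩ α γ ⁻¹' (c ∩ Dᶜ) := ⟨⟨hx, hxD⟩, hγ.1, hyD⟩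
    refine ⟨_, α γ '' (c ∩ D ∩ α γ ⁻¹' (c ∩ Dᶜ)), hcl, (image_meas μ₀ _ (hμ₀ γ) _ hcl).1, ⟨x, hxm⟩,
      ⟨_, mem_image_of_mem _ hxm⟩, fun z hz => hz.1.1, ?_, ?_, ?_⟩
    · rintro _ ⟨z, hz, rfl⟩; exact hz.2.1
    · rw [Set.disjoint_left]
      rintro _ hz ⟨w, hw, rfl⟩
      exact hw.2.2 hz.1.2
    · rintro ⟨μ, hp, hμ⟩
      simp only
      rw [(image_meas μ _ (hμ γ) _ hcl).2]

lemma zpow_inv (T : X ≃ₜ X) (μ : Measure X) (h : Measure.map T μ = μ) (z : ℤ) :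
    Measure.map (T ^ z : X ≃ₜ X) μ = μ := by
  let H : Subgroup (X ≃ₜ X) :=
    { carrier := {g | Measure.map g μ = μ}
      one_mem' := by
        change Measure.map id μ = μ
        exact Measure.map_id
      mul_mem' := by
        intro a b ha hb
        change Measure.map (a ∘ b) μ = μ
        rw [← Measure.map_map a.continuous.measurable b.continuous.measurable]
        change Measure.map b μ = μ at hb
        change Measure.map a μ = μ at ha
        rw [hb, ha]
      inv_mem' := by
        intro a ha
        change Measure.map a.symm μ = μ
        change Measure.map a μ = μ at ha
        conv_lhs => rw [← ha]
        rw [Measure.map_map a.symm.continuous.measurable a.continuous.measurable]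
        have : (a.symm ∘ a : X → X) = id := funext fun x => a.symm_apply_apply x
        rw [this, Measure.map_id] }
  exact H.zpow_mem (show T ∈ H from h) z

end PI

lemma cantor_perf (c : Set Cantor) (hc : IsOpen c) (x : Cantor) (hx : x ∈ c) : ∃ y ∈ c, y ≠ x := by
  have ht : Filter.Tendsto (fun n => Function.update x n (!x n)) Filter.atTop (nhds x) := by
    rw [tendsto_pi_nhds]
    intro i
    refine tendsto_const_nhds.congr' ?_
    filter_upwards [Filter.eventually_gt_atTop i] with n hn
    rw [Function.update_of_ne (by omega)]
  obtain ⟨n, hn⟩ := (ht.eventually (hc.mem_nhds hx)).exists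
  refine ⟨_, hn, fun h => ?_⟩
  have := congrFun h n
  simp at this

theorem dir2 {Γ : Type*} [Group Γ] [Countable Γ] [MeasurableSpace Cantor] [BorelSpace Cantor]
    (hamen : ∃ m : Set Γ → ℝ, IsInvFapm m)
    (α : Γ →* (Cantor ≃ₜ Cantor)) (hmin : IsMinimalAction α)
    (hcmp : ∀ A B : Set Cantor, IsClopen A → IsClopen B →
        (∀ μ : Measure Cantor, IsProbabilityMeasure μ → (∀ γ, Measure.map (α γ) μ = μ) → μ A < μ B) →
        ∃ (n : ℕ) (P : Fin n → Set Cantor) (g : Fin n → Cantor ≃ₜ Cantor),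
          (∀ i, ∀ μ : Measure Cantor, IsProbabilityMeasure μ → (∀ γ, Measure.map (α γ) μ = μ) →
            Measure.map ⇑(g i) μ = μ) ∧
          (∀ i, IsClopen (P i)) ∧
          (Pairwise fun i j => Disjoint (P i) (P j)) ∧
          (⋃ i, P i) = A ∧
          (Pairwise fun i j => Disjoint (⇑(g i) '' P i) (⇑(g j) '' P j)) ∧
          ∀ i, ⇑(g i) '' P i ⊆ B) :
    ∃ T : Cantor ≃ₜ Cantor, ∀ μ : Measure Cantor, IsProbabilityMeasure μ →
      (Measure.map T μ = μ ↔ ∀ γ, Measure.map (α γ) μ = μ) := by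
  have S := setup_of hamen α hmin cantor_perf hcmp
  have : Countable (TopologicalSpace.Clopens Cantor) :=
    TopologicalSpace.Clopens.countable_iff_secondCountable.2 inferInstance
  obtain ⟨f, hf⟩ := exists_surjective_nat (TopologicalSpace.Clopens Cantor × Γ)
  obtain ⟨T, hT, hν⟩ := S.tower_limit (P := fun n => (((f n).1 : Set Cantor), α (f n).2 ⁻¹' ((f n).1 : Set Cantor)))
    (by
      intro n
      refine ⟨(f n).1.isClopen, (f n).1.isClopen.preimage (α (f n).2).continuous, ?_⟩
      rintro ⟨μ, hp, hμ⟩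
      simp only
      rw [measure_preimage_of_map μ _ (hμ _) _ (f n).1.isClopen])
  refine ⟨T, fun μ hp => ⟨fun h γ => ?_, fun h => ?_⟩⟩
  · apply map_eq_of_clopen
    intro A hA
    obtain ⟨n, hn⟩ := hf (⟨A, hA⟩, γ)
    have := hν (fun A => (μ A).toReal) (by
      intro A B hA hB hd
      rw [measure_union hd hB.isOpen.measurableSet, ENNReal.toReal_add (measure_ne_top _ _) (measure_ne_top _ _)])
      (by
        intro A hA
        rw [measure_preimage_of_map μ _ h _ hA]) n
    simp only [hn] at this
    exact ((ENNReal.toReal_eq_toReal_iff' (measure_ne_top _ _) (measure_ne_top _ _)).1 this).symm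
  · apply map_eq_of_clopen
    intro A hA
    exact (ENNReal.toReal_eq_toReal_iff' (measure_ne_top _ _) (measure_ne_top _ _)).1 (hT ⟨μ, hp, h⟩ A hA)

lemma mem_zinv (T : Cantor ≃ₜ Cantor) (μ : @Measure Cantor (borel Cantor)) :
    μ ∈ invBorel (zpowersHom (Cantor ≃ₜ Cantor) T) ↔
      @IsProbabilityMeasure _ (borel Cantor) μ ∧ @Measure.map _ _ (borel Cantor) (borel Cantor) T μ = μ := by
  letI : MeasurableSpace Cantor := borel Cantor
  haveI : BorelSpace Cantor := ⟨rfl⟩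
  constructor
  · rintro ⟨hp, h⟩
    refine ⟨hp, ?_⟩
    have := h (Multiplicative.ofAdd 1)
    rwa [zpowersHom_apply, toAdd_ofAdd, zpow_one] at this
  · rintro ⟨hp, h⟩
    refine ⟨hp, fun z => ?_⟩
    rw [zpowersHom_apply]
    exact zpow_inv T μ h _

/-- Let `Γ` be a countable amenable group and `α` a minimal action of `Γ`
on the Cantor space. Then there is a homeomorphism `T` of the Cantor space whose `ℤ`-action
`n ↦ Tⁿ` has exactly the same invariant Borel probability measures as `α` iff `α` has
measured comparison (comparison implemented by elements of
`K(α) = {g ∈ Homeo(X) : g⋆μ = μ for all μ ∈ M(α)}`). -/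
theorem stmt19 {Γ : Type*} [Group Γ] [Countable Γ]
    (hamen : ∃ m : Set Γ → ℝ, IsInvFapm m)
    (α : Γ →* (Cantor ≃ₜ Cantor)) (hmin : IsMinimalAction α) :
    letI : MeasurableSpace Cantor := borel Cantor
    ((∃ T : Cantor ≃ₜ Cantor,
        invBorel (zpowersHom (Cantor ≃ₜ Cantor) T) = invBorel α) ↔
      (∀ A B : Set Cantor, IsClopen A → IsClopen B →
        (∀ μ ∈ invBorel α, μ A < μ B) →
        ∃ (n : ℕ) (P : Fin n → Set Cantor) (g : Fin n → Cantor ≃ₜ Cantor),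
          (∀ i, ∀ μ ∈ invBorel α, Measure.map ⇑(g i) μ = μ) ∧
          (∀ i, IsClopen (P i)) ∧
          (Pairwise fun i j => Disjoint (P i) (P j)) ∧
          (⋃ i, P i) = A ∧
          (Pairwise fun i j => Disjoint (⇑(g i) '' P i) (⇑(g j) '' P j)) ∧
          ∀ i, ⇑(g i) '' P i ⊆ B)) := by
  letI : MeasurableSpace Cantor := borel Cantor
  haveI : BorelSpace Cantor := ⟨rfl⟩
  constructor
  · rintro ⟨T, hT⟩ A B hA hB h
    obtain ⟨n, P, g, hg, hrest⟩ := dir1 T A B hA hB (by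
      intro μ hp hμ
      exact h μ (hT ▸ (mem_zinv T μ).2 ⟨hp, hμ⟩))
    refine ⟨n, P, g, fun i μ hμ => hg i μ ?_, hrest⟩
    rw [← hT] at hμ
    exact ((mem_zinv T μ).1 hμ).2
  · intro hcmp
    obtain ⟨T, hT⟩ := dir2 hamen α hmin (by
      intro A B hA hB h
      obtain ⟨n, P, g, hg, hrest⟩ := hcmp A B hA hB (fun μ hμ => h μ hμ.1 hμ.2)
      exact ⟨n, P, g, fun i μ hp hμ => hg i μ ⟨hp, hμ⟩, hrest⟩)
    refine ⟨T, Set.ext fun μ => ?_⟩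
    rw [mem_zinv]
    constructor
    · rintro ⟨hp, h⟩
      exact ⟨hp, (hT μ hp).1 h⟩
    · rintro ⟨hp, h⟩
      exact ⟨hp, (hT μ hp).2 h⟩
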